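/- arXiv:1912.05263 — 4 statements merged into one kernel-verified Lean document; each statement's English description precedes it below -/
import Mathlib

section
/- Let (A, 𝔪, 𝕜) be a Noetherian complete local ring containing the field 𝕜, R = A[[x₁,...,xₙ]], and M a finitely generated R-module with dim_𝕜 M/𝔪M < ∞, with annihilator J = Ann_R(M). Then there exist f₁,...,f_s ∈ A[x] (s ≥ n) generating J as an ideal of A[[x]], such that for each i = 1,...,n the element f_{n−i+1} lies in A[x₁,...,x_i] and is a Weierstrass polynomial in the variable x_i. -/
set_option synthInstance.maxHeartbeats 1000000
set_option maxHeartbeats 1000000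

/-- `f` is a Weierstrass polynomial with respect to the variable `xᵢ` (over
`A[[x₁,...,x_{i-1}]]`): it is monic of some degree `b` in `xᵢ`, its `xᵢ`-degree is `b`
with leading term exactly `xᵢ^b`, and the coefficients of `xᵢ^j` (`j < b`) lie in the
maximal ideal (their constant terms lie in `𝔪`). -/
def IsWeierstrassPoly {A : Type} [CommRing A] {n : ℕ} (𝔪 : Ideal A) (i : Fin n)
    (f : MvPolynomial (Fin n) A) : Prop :=
  ∃ b : ℕ,
    MvPolynomial.coeff (Finsupp.single i b) f = 1 ∧
    (∀ e ∈ f.support, e i ≤ b) ∧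
    (∀ e ∈ f.support, e i = b → e = Finsupp.single i b) ∧
    (∀ j < b, MvPolynomial.coeff (Finsupp.single i j) f ∈ 𝔪)

/-- `1 - D` is surjective when `D` is contracting for the coefficientwise `I`-adic filtration. -/
theorem WP.fixed {A : Type} [CommRing A] {n : ℕ} (I : Ideal A) [IsAdicComplete I A]
    (D : MvPowerSeries (Fin n) A →+ MvPowerSeries (Fin n) A)
    (hD : ∀ k g, (∀ e, MvPowerSeries.coeff e g ∈ I ^ k) →
      ∀ e, MvPowerSeries.coeff e (D g) ∈ I ^ (k + 1)) (g : MvPowerSeries (Fin n) A) :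
    ∃ G, G - D G = g := by
  have hj : ∀ j e, MvPowerSeries.coeff e (D^[j] g) ∈ I ^ j := by
    intro j
    induction j with
    | zero => simp
    | succ j ih => rw [Function.iterate_succ_apply']; exact hD j _ ih
  let S : ℕ → MvPowerSeries (Fin n) A := fun k => ∑ j ∈ Finset.range k, D^[j] g
  have hS : ∀ m k, m ≤ k → ∀ e, MvPowerSeries.coeff e (S k - S m) ∈ I ^ m := by
    intro m k hmk e
    have : S k - S m = ∑ j ∈ Finset.Ico m k, D^[j] g :=
      (Finset.sum_Ico_eq_sub _ hmk).symm
    rw [this, map_sum]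
    refine Ideal.sum_mem _ fun j hj' => ?_
    exact Ideal.pow_le_pow_right (Finset.mem_Ico.1 hj').1 (hj j e)
  have hL : ∀ e, ∃ L : A, ∀ k, MvPowerSeries.coeff e (S k) - L ∈ I ^ k := by
    intro e
    obtain ⟨L, hL⟩ := IsPrecomplete.prec (inferInstance : IsPrecomplete I A)
      (f := fun k => MvPowerSeries.coeff e (S k)) (by
        intro m k hmk
        rw [SModEq.sub_mem, smul_eq_mul, Ideal.mul_top, ← neg_mem_iff, neg_sub, ← map_sub]
        exact hS m k hmk e)
    refine ⟨L, fun k => ?_⟩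
    have := hL k
    rwa [SModEq.sub_mem, smul_eq_mul, Ideal.mul_top] at this
  choose L hL using hL
  let G : MvPowerSeries (Fin n) A := fun e => L e
  have hG : ∀ k e, MvPowerSeries.coeff e (S k - G) ∈ I ^ k := by
    intro k e
    rw [map_sub]
    exact hL e k
  refine ⟨G, ?_⟩
  have hSD : ∀ k, S (k + 1) - D (S k) = g := by
    intro k
    simp only [S, map_sum]
    rw [Finset.sum_range_succ', sub_eq_iff_eq_add]
    simp [Function.iterate_succ_apply', add_comm]
  ext e
  rw [IsHausdorff.eq_iff_smodEq (I := I)]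
  intro k
  rw [SModEq.sub_mem, smul_eq_mul, Ideal.mul_top, ← map_sub]
  have : G - D G - g = D (S k - G) - (S (k+1) - G) := by
    rw [map_sub]
    linear_combination hSD k
  rw [this, map_sub]
  exact sub_mem (Ideal.pow_le_pow_right (Nat.le_succ k) (hD k _ (hG k) e))
    (Ideal.pow_le_pow_right (Nat.le_succ k) (hG (k+1) e))

theorem WP.mul_mem {A : Type} [CommRing A] {n : ℕ} {I J : Ideal A}
    {f g : MvPowerSeries (Fin n) A} (hf : ∀ e, MvPowerSeries.coeff e f ∈ I)
    (hg : ∀ e, MvPowerSeries.coeff e g ∈ J) (e) : MvPowerSeries.coeff e (f * g) ∈ I * J := by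
  classical
  rw [MvPowerSeries.coeff_mul]
  exact Ideal.sum_mem _ fun p _ => Ideal.mul_mem_mul (hf _) (hg _)

/-- Simultaneous Weierstrass division by `x_i ^ b_i + u_i`. -/
theorem WP.division {A : Type} [CommRing A] {n : ℕ} (I : Ideal A) [IsAdicComplete I A]
    (b : Fin n → ℕ) (u : Fin n → MvPowerSeries (Fin n) A)
    (hu : ∀ i e, MvPowerSeries.coeff e (u i) ∈ I) (g : MvPowerSeries (Fin n) A) :
    ∃ r ∈ Submodule.span A ((fun e : Fin n →₀ ℕ => MvPolynomial.monomial e (1 : A)) ''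
        {e | ∀ i, e i < b i}),
      ∃ q : Fin n → MvPowerSeries (Fin n) A,
        g = (r : MvPowerSeries (Fin n) A) + ∑ i, q i * (MvPowerSeries.X i ^ b i + u i) := by
  classical
  have hch : ∀ e : Fin n →₀ ℕ, ∃ c : Option (Fin n),
      (∀ i, c = some i → b i ≤ e i) ∧ (c = none → ∀ i, e i < b i) := by
    intro e
    by_cases h : ∃ i, b i ≤ e i
    · obtain ⟨i, hi⟩ := h
      exact ⟨some i, by rintro j hj; cases hj; exact hi, by simp⟩
    · push Not at h
      exact ⟨none, by simp, fun _ => h⟩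
  choose c hc1 hc2 using hch
  let q : Fin n → MvPowerSeries (Fin n) A →+ MvPowerSeries (Fin n) A := fun i =>
    { toFun := fun G e => if c (e + Finsupp.single i (b i)) = some i then
        MvPowerSeries.coeff (e + Finsupp.single i (b i)) G else 0
      map_zero' := by funext e; simp; rfl
      map_add' := by
        intro x y
        funext e
        change (if c (e + Finsupp.single i (b i)) = some i then
          MvPowerSeries.coeff (e + Finsupp.single i (b i)) (x + y) else 0) =
          (if c (e + Finsupp.single i (b i)) = some i then
            MvPowerSeries.coeff (e + Finsupp.single i (b i)) x else 0) +
          (if c (e + Finsupp.single i (b i)) = some i then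
            MvPowerSeries.coeff (e + Finsupp.single i (b i)) y else 0)
        split_ifs <;> simp }
  have hq : ∀ i G e, MvPowerSeries.coeff e (q i G) =
      if c (e + Finsupp.single i (b i)) = some i then
        MvPowerSeries.coeff (e + Finsupp.single i (b i)) G else 0 := fun i G e => rfl
  have hfinset : {e : Fin n →₀ ℕ | ∀ i, e i < b i}.Finite := by
    refine (Set.finite_Iic (Finsupp.equivFunOnFinite.symm b)).subset ?_
    intro e he i
    exact (he i).le
  let T : Finset (Fin n →₀ ℕ) := {e ∈ hfinset.toFinset | c e = none}
  have hT : ∀ e, e ∈ T ↔ c e = none := by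
    intro e
    simp only [T, Finset.mem_filter, Set.Finite.mem_toFinset, Set.mem_ofPred_eq,
      and_iff_right_iff_imp]
    exact hc2 e
  let r : MvPowerSeries (Fin n) A → MvPolynomial (Fin n) A := fun G =>
    ∑ e ∈ T, MvPolynomial.monomial e (MvPowerSeries.coeff e G)
  have hdec : ∀ G, G = (r G : MvPowerSeries (Fin n) A) +
      ∑ i, q i G * MvPowerSeries.X i ^ b i := by
    intro G
    ext e
    rw [map_add, map_sum, MvPolynomial.coeff_coe]
    simp only [r, MvPolynomial.coeff_sum, MvPolynomial.coeff_monomial, MvPowerSeries.X_pow_eq,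
      MvPowerSeries.coeff_mul_monomial, hq, mul_one]
    rw [Finset.sum_ite_eq' T e, if_congr (hT e) rfl rfl]
    have h2 : ∀ i : Fin n, (if Finsupp.single i (b i) ≤ e then
        (if c (e - Finsupp.single i (b i) + Finsupp.single i (b i)) = some i then
          MvPowerSeries.coeff (e - Finsupp.single i (b i) + Finsupp.single i (b i)) G else 0)
        else 0) = if c e = some i then MvPowerSeries.coeff e G else 0 := by
      intro i
      by_cases h : Finsupp.single i (b i) ≤ e
      · rw [if_pos h, tsub_add_cancel_of_le h]
      · rw [if_neg h, if_neg]
        intro h'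
        exact h (Finsupp.single_le_iff.2 (hc1 e i h'))
    rw [Finset.sum_congr rfl fun i _ => h2 i]
    cases hce : c e with
    | none => simp
    | some i => simp
  let D : MvPowerSeries (Fin n) A →+ MvPowerSeries (Fin n) A :=
    -∑ i, (AddMonoidHom.mulRight (u i)).comp (q i)
  have hDa : ∀ G, D G = -∑ i, q i G * u i := by
    intro G
    simp [D]
  obtain ⟨G, hG⟩ := WP.fixed I D (by
    intro k g hg e
    rw [hDa, map_neg, neg_mem_iff, map_sum]
    refine Ideal.sum_mem _ fun i _ => ?_
    rw [pow_succ]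
    refine WP.mul_mem (fun e => ?_) (hu i) e
    rw [hq]
    split_ifs
    · exact hg _
    · exact zero_mem _) g
  refine ⟨r G, ?_, fun i => q i G, ?_⟩
  · refine Submodule.sum_mem _ fun e he => ?_
    have : MvPolynomial.monomial e (MvPowerSeries.coeff e G) =
      MvPowerSeries.coeff e G • MvPolynomial.monomial e (1 : A) := by
      rw [MvPolynomial.smul_monomial, smul_eq_mul, mul_one]
    rw [this]
    exact Submodule.smul_mem _ _ (Submodule.subset_span ⟨e, hc2 e ((hT e).1 he), rfl⟩)
  · rw [← hG, hDa]
    simp only [mul_add, Finset.sum_add_distrib]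
    linear_combination hdec G

theorem WP.cayley {A R M : Type} [CommRing A] [CommRing R] [Algebra A R] [AddCommGroup M]
    [Module A M] [Module R M] [IsScalarTower A R M] [Module.Finite A M] (x : R) (I : Ideal A)
    (h : ∀ m : M, x • m ∈ I • (⊤ : Submodule A M)) :
    ∃ p : Polynomial A, p.Monic ∧ (∀ k < p.natDegree, p.coeff k ∈ I) ∧
      ∀ m : M, Polynomial.aeval x p • m = 0 := by
  obtain ⟨p, hp, -, hc, h0⟩ :=
    LinearMap.exists_monic_and_natDegree_eq_and_coeff_mem_pow_and_aeval_eq_zero A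
      (Algebra.lsmul A A M x) I (by rintro _ ⟨m, rfl⟩; exact h m)
  refine ⟨p, hp, fun k hk => Ideal.pow_le_self (by omega) (hc k), fun m => ?_⟩
  rw [Polynomial.aeval_algHom_apply] at h0
  exact LinearMap.congr_fun h0 m

/-- A polynomial in `X i` as a power series, coefficientwise. -/
theorem WP.coeff_aeval {A : Type} [CommRing A] {n : ℕ} (i : Fin n) (p : Polynomial A)
    (e : Fin n →₀ ℕ) :
    MvPolynomial.coeff e (Polynomial.aeval (MvPolynomial.X i : MvPolynomial (Fin n) A) p) =
      if e = Finsupp.single i (e i) then p.coeff (e i) else 0 := by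
  classical
  rw [Polynomial.aeval_eq_sum_range, MvPolynomial.coeff_sum]
  simp only [MvPolynomial.coeff_smul, MvPolynomial.coeff_X_pow, smul_eq_mul, mul_ite, mul_one,
    mul_zero]
  split_ifs with h
  · have : ∀ j, (Finsupp.single i j = e) ↔ j = e i := by
      intro j
      constructor
      · rintro rfl; simp
      · rintro rfl; exact h.symm
    simp only [this, Finset.sum_ite_eq', Finset.mem_range]
    split_ifs with h'
    · rfl
    · rw [Polynomial.coeff_eq_zero_of_natDegree_lt (by omega)]
  · refine Finset.sum_eq_zero fun j _ => if_neg ?_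
    rintro rfl
    simp at h

theorem WP.nilp {A : Type} [CommRing A] [IsLocalRing A] {n : ℕ} (i : Fin n) (Q : Type)
    [AddCommGroup Q] [Module A Q] [Module (MvPowerSeries (Fin n) A) Q]
    [IsScalarTower A (MvPowerSeries (Fin n) A) Q] [Module.Finite A Q]
    (hQ : ∀ a ∈ IsLocalRing.maximalIdeal A, ∀ y : Q, a • y = 0) :
    ∃ a : ℕ, ∀ y : Q, (MvPowerSeries.X i ^ a : MvPowerSeries (Fin n) A) • y = 0 := by
  classical
  obtain ⟨p, hp, -, h0⟩ := WP.cayley (M := Q) (MvPowerSeries.X i : MvPowerSeries (Fin n) A)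
    (⊤ : Ideal A) (by simp)
  have hex : ∃ a, p.coeff a ∉ IsLocalRing.maximalIdeal A := by
    refine ⟨p.natDegree, ?_⟩
    rw [hp.coeff_natDegree]
    exact fun h => (IsLocalRing.maximalIdeal.isMaximal A).ne_top
      ((Ideal.eq_top_iff_one _).2 h)
  set a := Nat.find hex with ha
  have ha1 : p.coeff a ∉ IsLocalRing.maximalIdeal A := Nat.find_spec hex
  have ha2 : ∀ j < a, p.coeff j ∈ IsLocalRing.maximalIdeal A := fun j hj => by
    simpa using Nat.find_min hex hj
  refine ⟨a, ?_⟩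
  set x : MvPowerSeries (Fin n) A := MvPowerSeries.X i with hx
  let s : Polynomial A := Polynomial.divX^[a] p
  have key : ∀ k, p = (∑ j ∈ Finset.range k, Polynomial.C (p.coeff j) * Polynomial.X ^ j) +
      Polynomial.X ^ k * Polynomial.divX^[k] p ∧ ∀ l, (Polynomial.divX^[k] p).coeff l =
        p.coeff (l + k) := by
    intro k
    induction k with
    | zero => simp
    | succ k ih =>
      obtain ⟨h1, h2⟩ := ih
      refine ⟨?_, fun l => ?_⟩
      · rw [Finset.sum_range_succ, Function.iterate_succ_apply']
        conv_lhs => rw [h1, ← Polynomial.X_mul_divX_add (Polynomial.divX^[k] p), h2]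
        rw [zero_add]
        ring
      · rw [Function.iterate_succ_apply', Polynomial.coeff_divX, h2]
        congr 1
        ring
  obtain ⟨k1, k2⟩ := key a
  have hunit : IsUnit (Polynomial.aeval x s) := by
    rw [MvPowerSeries.isUnit_iff_constantCoeff]
    have : MvPowerSeries.constantCoeff (Polynomial.aeval x s) = p.coeff a := by
      rw [Polynomial.aeval_def, Polynomial.hom_eval₂, hx, MvPowerSeries.constantCoeff_X,
        Polynomial.eval₂_at_zero]
      rw [k2]
      simp [MvPowerSeries.algebraMap_apply]
    rw [this]
    simpa using ha1
  intro y
  have h1 := h0 y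
  rw [k1, map_add, add_smul, map_sum, Finset.sum_smul, Finset.sum_eq_zero, zero_add, map_mul,
    map_pow, Polynomial.aeval_X, mul_comm, mul_smul] at h1
  · exact (hunit.smul_eq_zero).1 h1
  · intro j hj
    rw [map_mul, Polynomial.aeval_C, mul_comm, mul_smul, algebraMap_smul,
      hQ _ (ha2 j (Finset.mem_range.1 hj)), smul_zero]

/-- `x_i ^ a M ⊆ 𝔪 M`. -/
theorem WP.pow_smul_mem {A : Type} [CommRing A] [IsLocalRing A] {n : ℕ} (i : Fin n) (M : Type)
    [AddCommGroup M] [Module A M] [Module (MvPowerSeries (Fin n) A) M]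
    [IsScalarTower A (MvPowerSeries (Fin n) A) M]
    (hfin : Module.Finite A
      (M ⧸ ((IsLocalRing.maximalIdeal A) • (⊤ : Submodule A M)))) :
    ∃ a : ℕ, ∀ y : M, (MvPowerSeries.X i ^ a : MvPowerSeries (Fin n) A) • y ∈
      ((IsLocalRing.maximalIdeal A).map (algebraMap A (MvPowerSeries (Fin n) A))) •
        (⊤ : Submodule (MvPowerSeries (Fin n) A) M) := by
  set N := ((IsLocalRing.maximalIdeal A).map (algebraMap A (MvPowerSeries (Fin n) A))) •
        (⊤ : Submodule (MvPowerSeries (Fin n) A) M) with hN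
  have hmem : ∀ a ∈ IsLocalRing.maximalIdeal A, ∀ y : M, a • y ∈ N := by
    intro a ha y
    rw [← algebraMap_smul (MvPowerSeries (Fin n) A) a y]
    exact Submodule.smul_mem_smul (Ideal.mem_map_of_mem _ ha) trivial
  have : Module.Finite A (M ⧸ N) := by
    let φ : M →ₗ[A] (M ⧸ N) := (N.mkQ).restrictScalars A
    have hφ : Function.Surjective φ := N.mkQ_surjective
    have hle : ((IsLocalRing.maximalIdeal A) • (⊤ : Submodule A M)) ≤ LinearMap.ker φ := by
      rw [Submodule.smul_le]
      intro a ha y _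
      exact (Submodule.Quotient.mk_eq_zero N).2 (hmem a ha y)
    refine Module.Finite.of_surjective (Submodule.liftQ _ φ hle) ?_
    intro z
    obtain ⟨y, rfl⟩ := hφ z
    exact ⟨Submodule.Quotient.mk y, rfl⟩
  obtain ⟨a, ha⟩ := WP.nilp i (M ⧸ N) (by
    intro a ha y
    obtain ⟨y, rfl⟩ := N.mkQ_surjective y
    exact (Submodule.Quotient.mk_eq_zero N).2 (hmem a ha y))
  refine ⟨a, fun y => ?_⟩
  have := ha (N.mkQ y)
  exact (Submodule.Quotient.mk_eq_zero N).1 this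

theorem WP.coeff_mem_of_mem_map {A : Type} [CommRing A] {n : ℕ} {I : Ideal A}
    {u : MvPowerSeries (Fin n) A} (hu : u ∈ I.map (algebraMap A (MvPowerSeries (Fin n) A)))
    (e) : MvPowerSeries.coeff e u ∈ I := by
  revert e
  refine Submodule.span_induction (p := fun u _ => ∀ e, MvPowerSeries.coeff e u ∈ I)
    ?_ ?_ ?_ ?_ hu
  · rintro _ ⟨a, ha, rfl⟩ e
    classical
    rw [MvPowerSeries.algebraMap_apply, MvPowerSeries.coeff_C]
    split_ifs
    · exact ha
    · exact zero_mem _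
  · intro e; simp
  · intro x y _ _ hx hy e
    rw [map_add]; exact add_mem (hx e) (hy e)
  · intro a x _ hx e
    have := WP.mul_mem (I := ⊤) (f := a) (fun _ => trivial) hx e
    rwa [Ideal.top_mul] at this

/-- `x_i ^ (b+1) + u ∈ Ann M` for some `u ∈ 𝔪 R`. -/
theorem WP.exists_pow {A : Type} [CommRing A] [IsLocalRing A] {n : ℕ} (i : Fin n) (M : Type)
    [AddCommGroup M] [Module A M] [Module (MvPowerSeries (Fin n) A) M]
    [IsScalarTower A (MvPowerSeries (Fin n) A) M] [Module.Finite (MvPowerSeries (Fin n) A) M]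
    (hfin : Module.Finite A
      (M ⧸ ((IsLocalRing.maximalIdeal A) • (⊤ : Submodule A M)))) :
    ∃ b : ℕ, ∃ u ∈ (IsLocalRing.maximalIdeal A).map (algebraMap A (MvPowerSeries (Fin n) A)),
      (MvPowerSeries.X i ^ (b + 1) + u : MvPowerSeries (Fin n) A) ∈
        Module.annihilator (MvPowerSeries (Fin n) A) M := by
  obtain ⟨a, ha⟩ := WP.pow_smul_mem i M hfin
  obtain ⟨p, hp, hc, h0⟩ := WP.cayley (A := MvPowerSeries (Fin n) A) (M := M) _ _ ha
  set x : MvPowerSeries (Fin n) A := MvPowerSeries.X i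
  set I := (IsLocalRing.maximalIdeal A).map (algebraMap A (MvPowerSeries (Fin n) A))
  refine ⟨a * p.natDegree, x * ∑ j ∈ Finset.range p.natDegree, p.coeff j * (x ^ a) ^ j, ?_, ?_⟩
  · refine Ideal.mul_mem_left _ _ (Ideal.sum_mem _ fun j hj => ?_)
    exact Ideal.mul_mem_right _ _ (hc j (Finset.mem_range.1 hj))
  · have : x ^ (a * p.natDegree + 1) + x * ∑ j ∈ Finset.range p.natDegree, p.coeff j * (x ^ a) ^ j
        = x * Polynomial.aeval (x ^ a) p := by
      rw [Polynomial.aeval_eq_sum_range, Finset.sum_range_succ, hp.coeff_natDegree]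
      simp only [smul_eq_mul]
      ring
    rw [this, Module.mem_annihilator]
    intro m
    rw [mul_smul, h0, smul_zero]

/-- The quotient of the power series ring by an ideal containing `x_i ^ b_i + u_i`. -/
theorem WP.finite_quot {A : Type} [CommRing A] {n : ℕ} (I : Ideal A) [IsAdicComplete I A]
    (b : Fin n → ℕ) (u : Fin n → MvPowerSeries (Fin n) A)
    (hu : ∀ i e, MvPowerSeries.coeff e (u i) ∈ I) (J : Ideal (MvPowerSeries (Fin n) A))
    (hJ : ∀ i, MvPowerSeries.X i ^ b i + u i ∈ J) :
    Module.Finite A (MvPowerSeries (Fin n) A ⧸ J) := by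
  have hfinset : {e : Fin n →₀ ℕ | ∀ i, e i < b i}.Finite := by
    refine (Set.finite_Iic (Finsupp.equivFunOnFinite.symm b)).subset ?_
    intro e he i
    exact (he i).le
  let W := Submodule.span A ((fun e : Fin n →₀ ℕ => MvPolynomial.monomial e (1 : A)) ''
        {e | ∀ i, e i < b i})
  have hW : Module.Finite A W := Module.Finite.span_of_finite A (hfinset.image _)
  let φ : W →ₗ[A] (MvPowerSeries (Fin n) A ⧸ J) :=
    ((Ideal.Quotient.mkₐ A J).toLinearMap.comp
      (MvPolynomial.coeToMvPowerSeries.algHom (σ := Fin n) (R := A) A).toLinearMap).comp W.subtype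
  refine Module.Finite.of_surjective φ ?_
  intro z
  obtain ⟨g, rfl⟩ := Ideal.Quotient.mk_surjective z
  obtain ⟨r, hr, q, hg⟩ := WP.division I b u hu g
  refine ⟨⟨r, hr⟩, ?_⟩
  have : φ ⟨r, hr⟩ = Ideal.Quotient.mk J (r : MvPowerSeries (Fin n) A) := by
    simp [φ, MvPowerSeries.map_id]
  rw [this, Ideal.Quotient.eq, ← neg_mem_iff, neg_sub, hg, add_sub_cancel_left]
  exact Ideal.sum_mem _ fun i _ => Ideal.mul_mem_left _ _ (hJ i)

/-- Weierstrass polynomials over `A` in each variable. -/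
theorem WP.exists_poly {A : Type} [CommRing A] {n : ℕ} (I : Ideal A)
    (J : Ideal (MvPowerSeries (Fin n) A)) [Module.Finite A (MvPowerSeries (Fin n) A ⧸ J)]
    (i : Fin n) (b : ℕ) (u : MvPowerSeries (Fin n) A)
    (hu : u ∈ I.map (algebraMap A (MvPowerSeries (Fin n) A)))
    (hJ : MvPowerSeries.X i ^ (b + 1) + u ∈ J) :
    ∃ p : Polynomial A, p.Monic ∧ (∀ k < p.natDegree, p.coeff k ∈ I) ∧
      Polynomial.aeval (MvPowerSeries.X i : MvPowerSeries (Fin n) A) p ∈ J := by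
  set x : MvPowerSeries (Fin n) A := MvPowerSeries.X i
  obtain ⟨p, hp, hc, h0⟩ := WP.cayley (A := A) (M := MvPowerSeries (Fin n) A ⧸ J) (x ^ (b + 1)) I
    (by
      intro m
      obtain ⟨g, rfl⟩ := Ideal.Quotient.mk_surjective m
      have h1 : x ^ (b + 1) • Ideal.Quotient.mk J g = Ideal.Quotient.mk J (-(u * g)) := by
        rw [← Ideal.Quotient.mk_eq_mk, ← Submodule.Quotient.mk_smul, Ideal.Quotient.mk_eq_mk,
          Ideal.Quotient.eq]
        have := Ideal.mul_mem_right g J hJ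
        convert this using 1
        rw [smul_eq_mul]; ring
      rw [h1]
      have h2 : -(u * g) ∈ I.map (algebraMap A (MvPowerSeries (Fin n) A)) :=
        neg_mem (Ideal.mul_mem_right _ _ hu)
      generalize -(u * g) = w at h2
      refine Submodule.span_induction (p := fun w _ => ∀ g, Ideal.Quotient.mk J (g * w) ∈
        I • (⊤ : Submodule A (MvPowerSeries (Fin n) A ⧸ J))) ?_ ?_ ?_ ?_ h2 1 |> fun h => by
          simpa using h
      · rintro _ ⟨a, ha, rfl⟩ g
        have : Ideal.Quotient.mk J (g * algebraMap A _ a) = a • Ideal.Quotient.mk J g := by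
          rw [mul_comm, ← Algebra.smul_def]; rfl
        rw [this]
        exact Submodule.smul_mem_smul ha trivial
      · simp
      · intro x y _ _ hx hy g
        rw [mul_add, map_add]; exact add_mem (hx g) (hy g)
      · intro a x _ hx g
        rw [smul_eq_mul, ← mul_assoc]; exact hx _)
  refine ⟨Polynomial.expand A (b + 1) p, hp.expand (Nat.succ_pos b), ?_, ?_⟩
  · intro k hk
    rw [Polynomial.natDegree_expand] at hk
    rw [Polynomial.coeff_expand (Nat.succ_pos b)]
    split_ifs with h
    · exact hc _ (Nat.div_lt_of_lt_mul (by rwa [mul_comm] at hk))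
    · exact zero_mem _
  · rw [Polynomial.expand_aeval]
    have := h0 (Ideal.Quotient.mk J 1)
    rwa [← Ideal.Quotient.mk_eq_mk, ← Submodule.Quotient.mk_smul, Ideal.Quotient.mk_eq_mk,
      Ideal.Quotient.eq_zero_iff_mem, smul_eq_mul, mul_one] at this

/-- Let `(A, 𝔪, 𝕜)` be a Noetherian complete local ring containing its
residue field `𝕜`, `R = A[[x₁,...,xₙ]]`, and `M` a finitely generated `R`-module with
`dim_𝕜 M/𝔪M < ∞` and annihilator `J = Ann_R(M)`.  Then there are polynomials
`f₁,...,f_s ∈ A[x]` (`s ≥ n`) generating `J` in `A[[x]]` such that for `i = 1,...,n` the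
element `f_{n−i+1}` lies in `A[x₁,...,x_i]` and is a Weierstrass polynomial in `x_i`. -/
theorem annihilator_generated_by_weierstrass_polynomials
    (A : Type) [CommRing A] [IsNoetherianRing A] [IsLocalRing A]
    [IsAdicComplete (IsLocalRing.maximalIdeal A) A]
    (k : Type) [Field k] [Algebra k A]
    (hres : Function.Bijective (algebraMap k (IsLocalRing.ResidueField A)))
    (n : ℕ) (M : Type) [AddCommGroup M]
    [Module (MvPowerSeries (Fin n) A) M] [Module A M]
    [IsScalarTower A (MvPowerSeries (Fin n) A) M]
    [Module.Finite (MvPowerSeries (Fin n) A) M]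
    (hfin : Module.Finite A
      (M ⧸ ((IsLocalRing.maximalIdeal A) • (⊤ : Submodule A M)))) :
    ∃ (s : ℕ) (hs : n ≤ s) (f : Fin s → MvPolynomial (Fin n) A),
      Module.annihilator (MvPowerSeries (Fin n) A) M =
        Ideal.span (Set.range fun j =>
          MvPolynomial.coeToMvPowerSeries.ringHom (f j)) ∧
      ∀ i : Fin n,
        (∀ e ∈ (f ⟨n - 1 - (i : ℕ), by have := i.2; omega⟩).support,
            ∀ j : Fin n, e j ≠ 0 → j ≤ i) ∧
        IsWeierstrassPoly (IsLocalRing.maximalIdeal A) i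
          (f ⟨n - 1 - (i : ℕ), by have := i.2; omega⟩) := by
  classical
  set 𝔪 := IsLocalRing.maximalIdeal A with h𝔪
  set J := Module.annihilator (MvPowerSeries (Fin n) A) M with hJ
  have h1 := fun i : Fin n => WP.exists_pow i M hfin
  choose b u hu huJ using h1
  have hfinJ : Module.Finite A (MvPowerSeries (Fin n) A ⧸ J) :=
    WP.finite_quot 𝔪 (fun i => b i + 1) u (fun i e => WP.coeff_mem_of_mem_map (hu i) e) J huJ
  have h2 := fun i : Fin n => WP.exists_poly 𝔪 J i (b i) (u i) (hu i) (huJ i)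
  choose p hp hpc hpJ using h2
  let F : Fin n → MvPolynomial (Fin n) A := fun i => Polynomial.aeval (MvPolynomial.X i) (p i)
  have hFc : ∀ i e, MvPolynomial.coeff e (F i) =
      if e = Finsupp.single i (e i) then (p i).coeff (e i) else 0 :=
    fun i e => WP.coeff_aeval i (p i) e
  have hFs : ∀ i, ∀ e ∈ (F i).support, e = Finsupp.single i (e i) ∧ e i ≤ (p i).natDegree := by
    intro i e he
    rw [MvPolynomial.mem_support_iff, hFc] at he
    split_ifs at he with h
    · exact ⟨h, Polynomial.le_natDegree_of_ne_zero he⟩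
    · exact absurd rfl he
  have hcoe : ∀ i, ((F i : MvPolynomial (Fin n) A) : MvPowerSeries (Fin n) A) =
      Polynomial.aeval (MvPowerSeries.X i : MvPowerSeries (Fin n) A) (p i) := by
    intro i
    have := Polynomial.aeval_algHom_apply
      (MvPolynomial.coeToMvPowerSeries.algHom (σ := Fin n) (R := A) A) (MvPolynomial.X i) (p i)
    simpa [MvPowerSeries.map_id, F] using this.symm
  let v : Fin n → MvPowerSeries (Fin n) A := fun i =>
    (F i : MvPowerSeries (Fin n) A) - MvPowerSeries.X i ^ (p i).natDegree
  have hv : ∀ i e, MvPowerSeries.coeff e (v i) ∈ 𝔪 := by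
    intro i e
    simp only [v, map_sub, MvPolynomial.coeff_coe, hFc, MvPowerSeries.coeff_X_pow]
    by_cases he : e = Finsupp.single i (e i)
    · rw [if_pos he]
      rcases lt_trichotomy (e i) (p i).natDegree with h | h | h
      · rw [if_neg, sub_zero]
        · exact hpc i _ h
        · intro h'; rw [h'] at h; simp at h
      · rw [if_pos (by rw [← h]; exact he), h, (hp i).coeff_natDegree, sub_self]
        exact zero_mem _
      · rw [if_neg, sub_zero, Polynomial.coeff_eq_zero_of_natDegree_lt h]
        · exact zero_mem _
        · intro h'; rw [h'] at h; simp at h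
    · rw [if_neg he, if_neg, sub_zero]
      · exact zero_mem _
      · intro h'; apply he; rw [h']; simp
  have hFv : ∀ i, (F i : MvPowerSeries (Fin n) A) = MvPowerSeries.X i ^ (p i).natDegree + v i := by
    intro i; simp [v]
  let B : Set (Fin n →₀ ℕ) := {e | ∀ i, e i < (p i).natDegree}
  have hB : B.Finite := by
    refine (Set.finite_Iic (Finsupp.equivFunOnFinite.symm fun i => (p i).natDegree)).subset ?_
    intro e he i
    exact (he i).le
  let W := Submodule.span A ((fun e : Fin n →₀ ℕ => MvPolynomial.monomial e (1 : A)) '' B)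
  have hW : W.FG := Submodule.fg_span (hB.image _)
  let ι := (MvPolynomial.coeToMvPowerSeries.algHom (σ := Fin n) (R := A) A).toLinearMap
  have hι : ∀ r, ι r = (r : MvPowerSeries (Fin n) A) := by
    intro r; simp [ι, MvPowerSeries.map_id]
  let W' : Submodule A (MvPolynomial (Fin n) A) := W ⊓ (J.restrictScalars A).comap ι
  have hW' : W'.FG := by
    have hN : IsNoetherian A W := isNoetherian_of_fg_of_noetherian W hW
    exact (isNoetherian_submodule.1 hN) W' inf_le_left
  obtain ⟨t, g, hg⟩ := Submodule.fg_iff_exists_fin_generating_family.1 hW'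
  have hgJ : ∀ j, (g j : MvPowerSeries (Fin n) A) ∈ J := by
    intro j
    have h : g j ∈ W' := hg ▸ Submodule.subset_span ⟨j, rfl⟩
    have := h.2
    rw [← hι]
    exact this
  let f : Fin (n + t) → MvPolynomial (Fin n) A := Fin.append (fun i => F i.rev) g
  have hf : ∀ (i : Fin n) h, f ⟨n - 1 - (i : ℕ), h⟩ = F i := by
    intro i h
    have : (⟨n - 1 - (i : ℕ), h⟩ : Fin (n + t)) = Fin.castAdd t i.rev := by
      ext; simp [Fin.val_rev]; omega
    rw [this]
    simp [f]
  refine ⟨n + t, Nat.le_add_right n t, f, ?_, ?_⟩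
  · apply le_antisymm
    · intro z hz
      set K := Ideal.span (Set.range fun j =>
          MvPolynomial.coeToMvPowerSeries.ringHom (f j)) with hK
      have hfK : ∀ j, (f j : MvPowerSeries (Fin n) A) ∈ K := fun j =>
        Ideal.subset_span ⟨j, rfl⟩
      have hFK : ∀ i, (F i : MvPowerSeries (Fin n) A) ∈ K := by
        intro i
        have := hfK (Fin.castAdd t i.rev)
        simpa [f] using this
      have hgK : ∀ j, (g j : MvPowerSeries (Fin n) A) ∈ K := by
        intro j
        have := hfK (Fin.natAdd n j)
        simpa [f] using this
      obtain ⟨r, hr, q, hz'⟩ := WP.division 𝔪 (fun i => (p i).natDegree) v hv z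
      have hsum : ∀ L : Ideal (MvPowerSeries (Fin n) A),
          (∀ i, (F i : MvPowerSeries (Fin n) A) ∈ L) →
          ∑ i, q i * (MvPowerSeries.X i ^ (p i).natDegree + v i) ∈ L := by
        intro L hL
        refine Ideal.sum_mem _ fun i _ => Ideal.mul_mem_left _ _ ?_
        rw [← hFv]; exact hL i
      have hrJ : (r : MvPowerSeries (Fin n) A) ∈ J := by
        rw [eq_sub_of_add_eq hz'.symm]
        exact sub_mem hz (hsum J fun i => by rw [hcoe]; exact hpJ i)
      have hrW : r ∈ W' := ⟨hr, by
        change ι r ∈ J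
        rw [hι]; exact hrJ⟩
      have hle : W' ≤ (K.restrictScalars A).comap ι := by
        rw [← hg, Submodule.span_le]
        rintro _ ⟨j, rfl⟩
        change ι (g j) ∈ K
        rw [hι]; exact hgK j
      have hrK : (r : MvPowerSeries (Fin n) A) ∈ K := by
        rw [← hι]; exact hle hrW
      rw [hz']
      exact add_mem hrK (hsum K hFK)
    · rw [Ideal.span_le]
      rintro _ ⟨j, rfl⟩
      change (f j : MvPowerSeries (Fin n) A) ∈ J
      refine Fin.addCases (fun i => ?_) (fun j => ?_) j
      · simp only [f, Fin.append_left]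
        rw [hcoe]; exact hpJ _
      · simp only [f, Fin.append_right]
        exact hgJ j
  · intro i
    rw [hf]
    refine ⟨?_, (p i).natDegree, ?_, ?_, ?_, ?_⟩
    · intro e he j hj
      rw [(hFs i e he).1, Finsupp.single_apply] at hj
      split_ifs at hj with h
      · exact h.ge
      · exact absurd rfl hj
    · rw [hFc]
      simp [(hp i).coeff_natDegree]
    · intro e he
      exact (hFs i e he).2
    · intro e he h
      rw [← h]; exact (hFs i e he).1
    · intro j hj
      rw [hFc]
      simpa using hpc i j hj
end

section
/- Let (A, 𝔪, 𝕜) be a Noetherian complete local ring containing a field 𝕜, R = A[[x₁,...,xₙ]], and M a finitely generated R-module with dim_𝕜 M/𝔪M < ∞. Then M admits a finite presentation over R whose presentation matrix has entries in the polynomial ring A[x]. -/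
set_option synthInstance.maxHeartbeats 1000000
set_option maxHeartbeats 1000000

lemma complete_surj {A : Type*} [CommRing A] (m : Ideal A) [IsAdicComplete m A] {ι κ : Type*}
    (L : (ι → A) →+ (κ → A))
    (h1 : ∀ (j : ℕ) (x : ι → A), (∀ i, x i ∈ m ^ j) → ∀ t, L x t ∈ m ^ j)
    (h2 : ∀ (j : ℕ) (y : κ → A), (∀ t, y t ∈ m ^ j) →
      ∃ x : ι → A, (∀ i, x i ∈ m ^ j) ∧ ∀ t, (y - L x) t ∈ m ^ (j + 1)) :
    Function.Surjective L := by
  intro y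
  choose! s hs1 hs2 using h2
  let r : ℕ → (κ → A) := fun j => Nat.rec y (fun j rj => rj - L (s j rj)) j
  have r0 : r 0 = y := rfl
  have rs : ∀ j, r (j + 1) = r j - L (s j (r j)) := fun j => rfl
  have hr : ∀ j t, r j t ∈ m ^ j := by
    intro j
    induction j with
    | zero => intro t; simp
    | succ j ih => intro t; rw [rs]; exact hs2 j _ ih t
  let S : ℕ → (ι → A) := fun j => ∑ l ∈ Finset.range j, s l (r l)
  have hS : ∀ j, r j = y - L (S j) := by
    intro j
    induction j with
    | zero => simp [S, r0]
    | succ j ih =>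
      rw [rs]
      simp only [S, Finset.sum_range_succ, map_add] at ih ⊢
      rw [← sub_sub, ← ih]
  have hc : ∀ i, ∃ x : A, ∀ j, S j i - x ∈ m ^ j := by
    intro i
    obtain ⟨x, hx⟩ := IsPrecomplete.prec' (I := m) (fun j => S j i) (by
      intro a b hab
      rw [SModEq.comm, SModEq.sub_mem]
      simp only [S, Finset.sum_apply, smul_eq_mul, Ideal.mul_top]
      rw [← Finset.sum_Ico_eq_sub _ hab]
      refine Ideal.sum_mem _ fun l hl => ?_
      exact Ideal.pow_le_pow_right (Finset.mem_Ico.mp hl).1 (hs1 l _ (hr l) i))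
    refine ⟨x, fun j => ?_⟩
    have := hx j
    rw [SModEq.sub_mem] at this
    simpa using this
  choose x hx using hc
  refine ⟨x, ?_⟩
  funext t
  symm
  rw [← sub_eq_zero]
  apply IsHausdorff.haus' (I := m)
  intro j
  rw [SModEq.sub_mem]
  simp only [smul_eq_mul, Ideal.mul_top, sub_zero]
  have e : y t - L x t = r j t + L (S j - x) t := by
    rw [hS, map_sub]; simp
  rw [e]
  exact Ideal.add_mem _ (hr j t) (h1 j _ (fun i => hx i j) t)

/-- The power series with given coefficients. -/
def ofFun {σ A : Type*} (f : (σ →₀ ℕ) → A) : MvPowerSeries σ A := f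

lemma coeff_ofFun {σ A : Type*} [Semiring A] (f : (σ →₀ ℕ) → A) (d : σ →₀ ℕ) :
    MvPowerSeries.coeff d (ofFun f) = f d := rfl

open MvPowerSeries in
lemma weier {A : Type*} [CommRing A] (m : Ideal A) [IsAdicComplete m A] {n : ℕ} (e : ℕ)
    (F : Fin n → MvPowerSeries (Fin n) A)
    (hF : ∀ i d, coeff d (F i - X i ^ e) ∈ m) :
    ∃ D : Finset (Fin n →₀ ℕ), ∀ f : MvPowerSeries (Fin n) A,
      ∃ (c : (Fin n →₀ ℕ) → A) (b : Fin n → MvPowerSeries (Fin n) A),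
        f = ∑ d ∈ D, monomial d (c d) + ∑ i, F i * b i := by
  classical
  let D : Finset (Fin n →₀ ℕ) := Finset.Iic (Finsupp.equivFunOnFinite.symm fun _ => e)
  refine ⟨D, ?_⟩
  have hD : ∀ d, d ∉ D → ∃ i, e ≤ d i := by
    intro d hd
    by_contra! h
    apply hd
    simp only [D, Finset.mem_Iic]
    intro i
    simpa using (h i).le
  have hD' : ∀ d, ∃ o : Option (Fin n), d ∉ D → ∃ i, o = some i ∧ e ≤ d i := by
    intro d
    by_cases hd : d ∈ D
    · exact ⟨none, fun h => absurd hd h⟩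
    · obtain ⟨i, hi⟩ := hD d hd
      exact ⟨some i, fun _ => ⟨i, rfl, hi⟩⟩
  choose ch hch using hD'
  let L' : (Option (Fin n) × (Fin n →₀ ℕ) → A) → MvPowerSeries (Fin n) A := fun x =>
    ∑ d ∈ D, monomial d (x (none, d)) + ∑ i, F i * ofFun (fun d => x (some i, d))
  let L : (Option (Fin n) × (Fin n →₀ ℕ) → A) →+ ((Fin n →₀ ℕ) → A) :=
    AddMonoidHom.mk' (fun x t => coeff t (L' x)) (by
      intro x y
      funext t
      have : ∀ i : Fin n, ofFun (fun d => x (some i, d) + y (some i, d)) =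
          ofFun (fun d => x (some i, d)) + ofFun (fun d => y (some i, d)) := fun i => rfl
      simp only [L', Pi.add_apply, this, mul_add, Finset.sum_add_distrib, map_add]
      abel)
  have hL : ∀ x t, L x t = coeff t (L' x) := fun x t => rfl
  have hmul : ∀ (I J : Ideal A) (f g : MvPowerSeries (Fin n) A), (∀ d, coeff d f ∈ I) →
      (∀ d, coeff d g ∈ J) → ∀ d, coeff d (f * g) ∈ I * J := by
    intro I J f g hf hg d
    rw [coeff_mul]
    exact Ideal.sum_mem _ fun p _ => Ideal.mul_mem_mul (hf _) (hg _)
  have key : Function.Surjective L := by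
    apply complete_surj m
    · intro j x hx t
      rw [hL, map_add, map_sum, map_sum]
      refine Ideal.add_mem _ (Ideal.sum_mem _ fun d _ => ?_) (Ideal.sum_mem _ fun i _ => ?_)
      · rw [coeff_monomial]; split_ifs
        · exact hx _
        · simp
      · have := hmul ⊤ (m ^ j) (F i) (ofFun fun d => x (some i, d)) (by simp) (fun d => hx (some i, d)) t
        rwa [Ideal.top_mul] at this
    · intro j y hy
      let b : Fin n → MvPowerSeries (Fin n) A := fun i => ofFun fun d =>
        if d + Finsupp.single i e ∉ D ∧ ch (d + Finsupp.single i e) = some i then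
          y (d + Finsupp.single i e) else 0
      have hb : ∀ i d, coeff d (b i) = if d + Finsupp.single i e ∉ D ∧
          ch (d + Finsupp.single i e) = some i then y (d + Finsupp.single i e) else 0 := fun i d => rfl
      have hbm : ∀ i d, coeff d (b i) ∈ m ^ j := by
        intro i d
        rw [hb]; split_ifs
        · exact hy _
        · simp
      refine ⟨fun z => z.1.elim (y z.2) (fun i => coeff z.2 (b i)), ?_, ?_⟩
      · rintro ⟨_ | i, d⟩
        · exact hy d
        · exact hbm i d
      · intro t
        have e1 : ofFun y =
            ∑ d ∈ D, monomial d (y d) + ∑ i, X i ^ e * b i := by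
          ext d
          rw [map_add, map_sum, map_sum]
          simp only [coeff_monomial, X_pow_eq, coeff_monomial_mul, one_mul, hb,
            Finset.sum_ite_eq]
          have hle : ∀ i : Fin n, Finsupp.single i e ≤ d ↔ e ≤ d i := by
            intro i; simp [Finsupp.single_le_iff]
          by_cases hd : d ∈ D
          · rw [if_pos hd, Finset.sum_eq_zero]
            · simp [coeff_ofFun]
            · intro i _
              split_ifs with h h'
              · rw [tsub_add_cancel_of_le h] at h'
                exact absurd hd h'.1
              · rfl
              · rfl
          · obtain ⟨i₀, hi0, hle0⟩ := hch d hd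
            rw [if_neg hd, Finset.sum_eq_single i₀]
            · have h := (hle i₀).2 hle0
              rw [if_pos h, tsub_add_cancel_of_le h, if_pos ⟨hd, hi0⟩, zero_add]
              rfl
            · intro i _ hi
              split_ifs with h h'
              · rw [tsub_add_cancel_of_le h] at h'
                exact absurd (Option.some.inj (h'.2.symm.trans hi0)) hi
              · rfl
              · rfl
            · simp
        have e2 : ofFun y - L' (fun z => z.1.elim (y z.2) (fun i => coeff z.2 (b i))) =
            - ∑ i, (F i - X i ^ e) * b i := by
          change ofFun y - (∑ d ∈ D, monomial d (y d) + ∑ i, F i * b i) = _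
          simp only [sub_mul, Finset.sum_sub_distrib]
          rw [e1]
          ring
        rw [Pi.sub_apply, hL, ← coeff_ofFun y t, ← map_sub, e2, map_neg, map_sum]
        refine neg_mem (Ideal.sum_mem _ fun i _ => ?_)
        rw [pow_succ']
        exact hmul m (m ^ j) _ _ (hF i) (hbm i) t
  intro f
  obtain ⟨x, hx⟩ := key (fun d => coeff d f)
  exact ⟨fun d => x (none, d), fun i => ofFun fun d => x (some i, d), by
    ext t; exact (congrFun hx t).symm⟩

open MvPowerSeries in
/-- A monic polynomial in `X i` over a local ring is, modulo the maximal ideal, a unit times a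
power of `X i`. -/
lemma weier_prep {A : Type*} [CommRing A] [IsLocalRing A] {n : ℕ} (i : Fin n)
    (q : Polynomial A) (hq : q.Monic) (F : MvPowerSeries (Fin n) A)
    (hF : MvPowerSeries.map (IsLocalRing.residue A) F =
      MvPowerSeries.map (IsLocalRing.residue A) (Polynomial.aeval (X i) q)) :
    ∃ (a : ℕ) (u : MvPowerSeries (Fin n) A),
      MvPowerSeries.map (IsLocalRing.residue A) (F * u) = X i ^ a := by
  have hmap : ∀ p : Polynomial A, MvPowerSeries.map (IsLocalRing.residue A)
      (Polynomial.aeval (X i : MvPowerSeries (Fin n) A) p) =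
      Polynomial.aeval (X i : MvPowerSeries (Fin n) (IsLocalRing.ResidueField A))
        (p.map (IsLocalRing.residue A)) := by
    intro p
    rw [Polynomial.aeval_def, Polynomial.hom_eval₂, Polynomial.aeval_def, Polynomial.eval₂_map,
      MvPowerSeries.map_X]
    congr 1
    ext1 a
    simp [MvPowerSeries.algebraMap_apply]
  obtain ⟨w, hw, hnd⟩ := Polynomial.exists_eq_pow_rootMultiplicity_mul_and_not_dvd
    (q.map (IsLocalRing.residue A)) (hq.map _).ne_zero 0
  rw [Polynomial.C_0, sub_zero] at hw hnd
  obtain ⟨w', hw'⟩ := Polynomial.map_surjective _ (IsLocalRing.residue_surjective (R := A)) w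
  set a := Polynomial.rootMultiplicity 0 (q.map (IsLocalRing.residue A))
  have hu : IsUnit (Polynomial.aeval (X i : MvPowerSeries (Fin n) A) w') := by
    rw [isUnit_iff_constantCoeff]
    have : constantCoeff (Polynomial.aeval (X i : MvPowerSeries (Fin n) A) w') = w'.coeff 0 := by
      rw [Polynomial.aeval_def, Polynomial.hom_eval₂, constantCoeff_X, Polynomial.eval₂_at_zero]
      simp [MvPowerSeries.algebraMap_apply]
    rw [this]
    by_contra h
    apply hnd
    rw [Polynomial.X_dvd_iff, ← hw', Polynomial.coeff_map]
    rwa [IsLocalRing.residue_eq_zero_iff, IsLocalRing.mem_maximalIdeal]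
  obtain ⟨u, hu⟩ := hu.exists_right_inv
  refine ⟨a, u, ?_⟩
  rw [map_mul, hF, hmap, hw, ← hw', map_mul, ← hmap w', mul_assoc, ← map_mul, hu]
  simp

open MvPowerSeries in
/-- Division by almost-distinguished elements annihilating a module. -/
lemma weier_div {A : Type*} [CommRing A] [IsLocalRing A]
    [IsAdicComplete (IsLocalRing.maximalIdeal A) A] {n : ℕ}
    (q : Fin n → Polynomial A) (hq : ∀ i, (q i).Monic) (F : Fin n → MvPowerSeries (Fin n) A)
    (hF : ∀ i, MvPowerSeries.map (IsLocalRing.residue A) (F i) =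
      MvPowerSeries.map (IsLocalRing.residue A) (Polynomial.aeval (X i) (q i))) :
    ∃ D : Finset (Fin n →₀ ℕ), ∀ f : MvPowerSeries (Fin n) A,
      ∃ (c : (Fin n →₀ ℕ) → A) (b : Fin n → MvPowerSeries (Fin n) A),
        f = ∑ d ∈ D, monomial d (c d) + ∑ i, F i * b i := by
  choose a u h using fun i => weier_prep i (q i) (hq i) (F i) (hF i)
  let e := ∑ i, a i
  have he : ∀ i, a i ≤ e := fun i => Finset.single_le_sum (fun _ _ => Nat.zero_le _)
    (Finset.mem_univ i)
  obtain ⟨D, hD⟩ := weier (IsLocalRing.maximalIdeal A) e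
    (fun i => F i * u i * X i ^ (e - a i)) (by
      intro i d
      rw [← IsLocalRing.residue_eq_zero_iff, ← MvPowerSeries.coeff_map, map_sub, map_mul, h,
        map_pow, map_pow, MvPowerSeries.map_X, ← pow_add, Nat.add_sub_cancel' (he i), sub_self,
        map_zero])
  refine ⟨D, fun f => ?_⟩
  obtain ⟨c, b, hf⟩ := hD f
  exact ⟨c, fun i => u i * X i ^ (e - a i) * b i, by simpa only [mul_assoc] using hf⟩

lemma exists_monic_kill {A R N : Type*} [CommRing A] [CommRing R] [Algebra A R] [AddCommGroup N]
    [Module A N] [Module R N] [IsScalarTower A R N] [Module.Finite A N] (r : R) :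
    ∃ p : Polynomial A, p.Monic ∧ ∀ z : N, Polynomial.aeval r p • z = 0 := by
  obtain ⟨p, hp, h⟩ := Algebra.IsIntegral.isIntegral (R := A) (Algebra.lsmul A A N r)
  refine ⟨p, hp, fun z => ?_⟩
  rw [← Polynomial.aeval_def, Polynomial.aeval_algHom_apply] at h
  exact congrArg (fun f : Module.End A N => f z) h

open MvPowerSeries in
lemma finite_over_base {A : Type*} [CommRing A] [IsLocalRing A]
    [IsAdicComplete (IsLocalRing.maximalIdeal A) A] {n : ℕ} {M : Type*} [AddCommGroup M]
    [Module (MvPowerSeries (Fin n) A) M] [Module A M]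
    [IsScalarTower A (MvPowerSeries (Fin n) A) M]
    [Module.Finite (MvPowerSeries (Fin n) A) M]
    (hfin : Module.Finite A
      (M ⧸ ((IsLocalRing.maximalIdeal A) • (⊤ : Submodule A M)))) : Module.Finite A M := by
  classical
  let R := MvPowerSeries (Fin n) A
  let I : Ideal R := (IsLocalRing.maximalIdeal A).map (algebraMap A R)
  have hI : ∀ f ∈ I, MvPowerSeries.map (IsLocalRing.residue A) f = 0 := by
    intro f hf
    have : I ≤ RingHom.ker (MvPowerSeries.map (σ := Fin n) (IsLocalRing.residue A)) := by
      rw [Ideal.map_le_iff_le_comap]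
      intro a ha
      rw [← IsLocalRing.residue_eq_zero_iff] at ha
      change MvPowerSeries.map _ (algebraMap A (MvPowerSeries (Fin n) A) a) = 0
      simp [MvPowerSeries.algebraMap_apply, ha]
    exact this hf
  have hfin' : Module.Finite A (M ⧸ (I • (⊤ : Submodule R M))) := by
    let φ : M →ₗ[A] (M ⧸ (I • (⊤ : Submodule R M))) :=
      (Submodule.mkQ (I • (⊤ : Submodule R M))).restrictScalars A
    have hle : (IsLocalRing.maximalIdeal A) • (⊤ : Submodule A M) ≤ LinearMap.ker φ := by
      rw [Submodule.smul_le]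
      intro a ha z _
      rw [LinearMap.mem_ker]
      change Submodule.Quotient.mk (a • z) = _
      rw [Submodule.Quotient.mk_eq_zero, ← algebraMap_smul R a z]
      exact Submodule.smul_mem_smul (Ideal.mem_map_of_mem _ ha) trivial
    refine Module.Finite.of_surjective (Submodule.liftQ _ φ hle) ?_
    rintro ⟨z⟩
    exact ⟨Submodule.Quotient.mk z, rfl⟩
  have hF : ∀ i : Fin n, ∃ (q : Polynomial A) (F : R), q.Monic ∧ 
      MvPowerSeries.map (IsLocalRing.residue A) F =
      MvPowerSeries.map (IsLocalRing.residue A) (Polynomial.aeval (X i) q) ∧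
      ∀ z : M, F • z = 0 := by
    intro i
    obtain ⟨p, hp, hpk⟩ := exists_monic_kill (A := A) (R := R)
      (N := M ⧸ (I • (⊤ : Submodule R M))) (X i)
    set G : R := Polynomial.aeval (X i) p with hG
    obtain ⟨P, hP, -, hPc, hP0⟩ :=
      LinearMap.exists_monic_and_natDegree_eq_and_coeff_mem_pow_and_aeval_eq_zero
        R (Algebra.lsmul R R M G) I (by
        rintro _ ⟨z, rfl⟩
        have := hpk (Submodule.Quotient.mk z)
        rw [← Submodule.Quotient.mk_smul, Submodule.Quotient.mk_eq_zero] at this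
        exact this)
    refine ⟨p ^ P.natDegree, Polynomial.aeval G P, hp.pow _, ?_, ?_⟩
    · rw [map_pow, ← hG, Polynomial.aeval_eq_sum_range, Finset.sum_range_succ, map_add, map_sum,
        Finset.sum_eq_zero, zero_add]
      · rw [Polynomial.coeff_natDegree, hP.leadingCoeff, one_smul]
      · intro k hk
        have hk := Finset.mem_range.mp hk
        rw [smul_eq_mul, map_mul, hI, zero_mul]
        exact Ideal.pow_le_self (by omega) (hPc k)
    · intro z
      rw [Polynomial.aeval_algHom_apply] at hP0
      exact congrArg (fun f : Module.End R M => f z) hP0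
  choose q F hq hqF hFz using hF
  obtain ⟨D, hD⟩ := weier_div q hq F hqF
  obtain ⟨S, hS⟩ := Module.Finite.fg_top (R := R) (M := M)
  refine ⟨⟨Finset.image₂ (fun d s => (monomial d (1 : A) : R) • s) D S, ?_⟩⟩
  rw [eq_top_iff]
  intro z _
  have hz : z ∈ Submodule.span R (S : Set M) := by rw [hS]; trivial
  obtain ⟨f, -, rfl⟩ := Submodule.mem_span_finset.mp hz
  refine Submodule.sum_mem _ fun s hs => ?_
  obtain ⟨c, b, hf⟩ := hD (f s)
  rw [hf, add_smul, Finset.sum_smul, Finset.sum_smul]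
  refine Submodule.add_mem _ (Submodule.sum_mem _ fun d hd => ?_)
    (Submodule.sum_mem _ fun i _ => ?_)
  · have : monomial d (c d) = c d • (monomial d (1 : A) : R) := by
      rw [← map_smul, smul_eq_mul, mul_one]
    rw [this, smul_assoc]
    exact Submodule.smul_mem _ _ (Submodule.subset_span
      (Finset.mem_coe.mpr (Finset.mem_image₂_of_mem hd hs)))
  · rw [mul_smul, hFz]
    exact zero_mem _

/-- Let `(A, 𝔪, 𝕜)` be a Noetherian complete local ring containing its
residue field `𝕜`, `R = A[[x₁,...,xₙ]]`, and `M` a finitely generated `R`-module with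
`dim_𝕜 M/𝔪M < ∞`.  Then `M` admits a finite presentation over `R` whose presentation
matrix has entries in the polynomial ring `A[x]`. -/
theorem polynomially_presented_of_complete_local
    (A : Type) [CommRing A] [IsNoetherianRing A] [IsLocalRing A]
    [IsAdicComplete (IsLocalRing.maximalIdeal A) A]
    (k : Type) [Field k] [Algebra k A]
    (hres : Function.Bijective (algebraMap k (IsLocalRing.ResidueField A)))
    (n : ℕ) (M : Type) [AddCommGroup M]
    [Module (MvPowerSeries (Fin n) A) M] [Module A M]
    [IsScalarTower A (MvPowerSeries (Fin n) A) M]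
    [Module.Finite (MvPowerSeries (Fin n) A) M]
    (hfin : Module.Finite A
      (M ⧸ ((IsLocalRing.maximalIdeal A) • (⊤ : Submodule A M)))) :
    ∃ (p q : ℕ) (T : Matrix (Fin q) (Fin p) (MvPolynomial (Fin n) A))
      (g : (Fin q → MvPowerSeries (Fin n) A) →ₗ[MvPowerSeries (Fin n) A] M),
      Function.Surjective g ∧
      LinearMap.ker g = LinearMap.range
        (Matrix.mulVecLin
          (T.map fun t => MvPolynomial.coeToMvPowerSeries.ringHom t)) := by
  have hMA : Module.Finite A M := finite_over_base (n := n) hfin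
  obtain ⟨q, g, hg⟩ := Module.Finite.exists_fin' (MvPowerSeries (Fin n) A) M
  choose P hP hPz using fun i : Fin n =>
    exists_monic_kill (A := A) (N := M) (MvPowerSeries.X i : MvPowerSeries (Fin n) A)
  obtain ⟨D, hD⟩ := weier_div P hP _ (fun i => rfl)
  let ρ : MvPolynomial (Fin n) A →+* MvPowerSeries (Fin n) A :=
    MvPolynomial.coeToMvPowerSeries.ringHom
  let φ : (Fin q → MvPolynomial (Fin n) A) →ₛₗ[ρ] (Fin q → MvPowerSeries (Fin n) A) :=
    { toFun := fun v j => ρ (v j)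
      map_add' := fun v w => by funext j; simp
      map_smul' := fun c v => by funext j; simp }
  have hφ : ∀ v j, φ v j = ρ (v j) := fun v j => rfl
  let W : Submodule (MvPolynomial (Fin n) A) (Fin q → MvPolynomial (Fin n) A) :=
    (LinearMap.ker g).comap φ
  have hW : W.FG := IsNoetherian.noetherian W
  obtain ⟨p, w, hw⟩ := Submodule.fg_iff_exists_fin_generating_family.mp hW
  refine ⟨p, q, Matrix.of fun i j => w j i, g, hg, ?_⟩
  rw [Matrix.range_mulVecLin]
  have hcol : Set.range (((Matrix.of fun i j => w j i).map
      fun t => MvPolynomial.coeToMvPowerSeries.ringHom t).col) = Set.range (fun j => φ (w j)) := rfl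
  rw [hcol]
  have hWle : W ≤ (Submodule.span (MvPowerSeries (Fin n) A)
      (Set.range (fun j => φ (w j)))).comap φ := by
    rw [← hw, Submodule.span_le]
    rintro _ ⟨j, rfl⟩
    exact Submodule.subset_span ⟨j, rfl⟩
  apply le_antisymm
  · intro r hr
    choose c b hcb using fun j => hD (r j)
    let a : Fin q → MvPolynomial (Fin n) A := fun j => ∑ d ∈ D, MvPolynomial.monomial d (c j d)
    let E : Fin n → Fin q → (Fin q → MvPolynomial (Fin n) A) := fun i j =>
      Pi.single j (Polynomial.aeval (MvPolynomial.X i) (P i))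
    have hρ : ∀ i, ρ (Polynomial.aeval (MvPolynomial.X i) (P i)) =
        Polynomial.aeval (MvPowerSeries.X i) (P i) := by
      intro i
      rw [Polynomial.aeval_def, Polynomial.hom_eval₂, Polynomial.aeval_def]
      congr 1
      · ext1 x
        simp [ρ, MvPowerSeries.algebraMap_apply]
      · simp [ρ]
    have hφE : ∀ i j, φ (E i j) = (Polynomial.aeval (MvPowerSeries.X i) (P i) :
        MvPowerSeries (Fin n) A) • Pi.single j 1 := by
      intro i j
      funext l
      rw [hφ, Pi.smul_apply]
      by_cases h : l = j
      · subst h; simp [E, hρ]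
      · simp [E, h]
    have hE : ∀ i j, E i j ∈ W := by
      intro i j
      change g (φ (E i j)) = 0
      rw [hφE, map_smul, hPz]
    have hr2 : r = φ a + ∑ i, ∑ j, b j i • φ (E i j) := by
      funext l
      rw [Pi.add_apply, hφ, hcb l]
      congr 1
      · simp [a, ρ]
      · simp only [Finset.sum_apply, hφE, Pi.smul_apply, smul_eq_mul]
        refine Finset.sum_congr rfl fun i _ => ?_
        rw [Finset.sum_eq_single l]
        · simp [mul_comm]
        · intro j _ hj; simp [Pi.single_apply, hj.symm]
        · simp
    have hs : ∑ i, ∑ j, b j i • φ (E i j) ∈ LinearMap.ker g :=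
      Submodule.sum_mem _ fun i _ => Submodule.sum_mem _ fun j _ =>
        Submodule.smul_mem _ _ (hE i j)
    have ha : a ∈ W := by
      change φ a ∈ LinearMap.ker g
      rw [eq_sub_of_add_eq hr2.symm]
      exact Submodule.sub_mem _ hr hs
    rw [hr2]
    exact Submodule.add_mem _ (hWle ha) (Submodule.sum_mem _ fun i _ =>
      Submodule.sum_mem _ fun j _ => Submodule.smul_mem _ _ (hWle (hE i j)))
  · rw [Submodule.span_le]
    rintro _ ⟨j, rfl⟩
    have : w j ∈ W := hw ▸ Submodule.subset_span ⟨j, rfl⟩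
    exact this
end

section
/- Let A be a Noetherian ring, R = A[[x₁,...,xₙ]], and M a finitely generated R-module that is also finitely generated as an A-module. Then for every prime 𝔭 ∈ Spec A, the completed fibre dimension satisfies dim_{k(𝔭)} M̂(𝔭) ≤ dim_{k(𝔭)} M ⊗_A k(𝔭), and the function 𝔭 ↦ dim_{k(𝔭)} M̂(𝔭) is upper semicontinuous on Spec A. -/
set_option synthInstance.maxHeartbeats 1000000
set_option maxHeartbeats 1000000

open TensorProduct

noncomputable section

/-- The residue field `k(𝔭) = A_𝔭/𝔭A_𝔭` of `A` at a prime `𝔭`. -/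
abbrev resF (A : Type) [CommRing A] (p : PrimeSpectrum A) : Type :=
  IsLocalRing.ResidueField (Localization.AtPrime p.asIdeal)

variable (A : Type) [CommRing A] (n : ℕ) (M : Type) [AddCommGroup M]
  [Module (MvPowerSeries (Fin n) A) M] [Module A M]
  [IsScalarTower A (MvPowerSeries (Fin n) A) M]

/-- The ideal `⟨x₁,...,xₙ⟩ ⊂ A[[x₁,...,xₙ]]`. -/
def xIdeal : Ideal (MvPowerSeries (Fin n) A) :=
  Ideal.span (Set.range MvPowerSeries.X)

/-- The quotient `M/⟨x⟩^m M`. -/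
abbrev fibQ (m : ℕ) : Type :=
  M ⧸ ((xIdeal A n ^ m) • (⊤ : Submodule (MvPowerSeries (Fin n) A) M))

/-- The natural `A`-linear transition map `M/⟨x⟩^(m+1) M → M/⟨x⟩^m M`. -/
def transQ (m : ℕ) : fibQ A n M (m + 1) →ₗ[A] fibQ A n M m :=
  (Submodule.mapQ _ _ LinearMap.id
    (by
      rw [Submodule.comap_id]
      exact Submodule.smul_mono_left
        (Ideal.pow_le_pow_right (Nat.le_succ m)))).restrictScalars A

/-- The completed fibre `M̂(𝔭) = lim_m (M/⟨x⟩^m M) ⊗_A k(𝔭)`, realized as the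
`k(𝔭)`-submodule of compatible families in the product. -/
def completedFibre (p : PrimeSpectrum A) :
    Submodule (resF A p) (∀ m : ℕ, (resF A p) ⊗[A] fibQ A n M m) where
  carrier := { f | ∀ m,
    LinearMap.baseChange (resF A p) (transQ A n M m) (f (m + 1)) = f m }
  zero_mem' := fun m => by simp
  add_mem' := fun {a b} ha hb m => by
    simp only [Pi.add_apply, map_add, ha m, hb m]
  smul_mem' := fun c a ha m => by
    simp only [Pi.smul_apply, map_smul, ha m]

/-- The completed fibre dimension `d̂_𝔭(M) = dim_{k(𝔭)} M̂(𝔭)`. -/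
def dHat (p : PrimeSpectrum A) : ℕ :=
  Module.finrank (resF A p) (completedFibre A n M p)

/-- Upper semicontinuity of the fibre rank of a finite module. -/
lemma aux_fibre_rank_usc (B : Type) [CommRing B] (Q : Type) [AddCommGroup Q] [Module B Q]
    [Module.Finite B Q] (p : PrimeSpectrum B) :
    ∃ U : Set (PrimeSpectrum B), IsOpen U ∧ p ∈ U ∧ ∀ q ∈ U,
      Module.finrank (resF B q) (resF B q ⊗[B] Q) ≤
        Module.finrank (resF B p) (resF B p ⊗[B] Q) := by
  classical
  obtain ⟨κ, a, ha, hsp, hli⟩ := exists_linearIndependent' (resF B p)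
    (fun x : Q => (1 : resF B p) ⊗ₜ[B] x)
  have htop : Submodule.span (resF B p) (Set.range fun x : Q => (1 : resF B p) ⊗ₜ[B] x) = ⊤ := by
    have := Submodule.baseChange_eq_span (A := resF B p) (⊤ : Submodule B Q)
    rw [Submodule.baseChange_top] at this
    rw [this]
    congr 1
    ext y
    simp
  rw [htop] at hsp
  let b := Module.Basis.mk hli hsp.ge
  have : Finite κ := Module.Finite.finite_basis b
  have : Fintype κ := Fintype.ofFinite κ
  let N : Submodule B Q := Submodule.span B (Set.range a)
  have hbc : ∀ q : PrimeSpectrum B, N.baseChange (resF B q) =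
      Submodule.span (resF B q) (Set.range fun i => (1 : resF B q) ⊗ₜ[B] a i) := by
    intro q
    rw [Submodule.baseChange_span, ← Set.range_comp]
    rfl
  have hex : ∀ q : PrimeSpectrum B, q ∉ Module.support B (Q ⧸ N) ↔
      N.baseChange (resF B q) = ⊤ := by
    intro q
    have h : Function.Exact (N.subtype.lTensor (resF B q)) (N.mkQ.lTensor (resF B q)) :=
      lTensor_exact (resF B q) (LinearMap.exact_subtype_mkQ N) N.mkQ_surjective
    have hs := LinearMap.lTensor_surjective (resF B q) N.mkQ_surjective
    rw [Module.mem_support_iff_nontrivial_residueField_tensorProduct, not_nontrivial_iff_subsingleton]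
    constructor
    · intro _
      rw [eq_top_iff]
      intro v _
      exact (h v).1 (Subsingleton.elim _ _)
    · intro ht
      refine subsingleton_of_forall_eq 0 fun w => ?_
      obtain ⟨v, rfl⟩ := hs w
      have hv : v ∈ N.baseChange (resF B q) := ht ▸ Submodule.mem_top
      exact (h v).2 hv
  refine ⟨(Module.support B (Q ⧸ N))ᶜ, (Module.isClosed_support).isOpen_compl, ?_, ?_⟩
  · rw [Set.mem_compl_iff, hex, hbc]
    exact hsp
  · intro q hq
    rw [Set.mem_compl_iff, hex, hbc] at hq
    rw [Module.finrank_eq_card_basis b, ← finrank_top (resF B q), ← hq]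
    exact finrank_range_le_card _

/-- The projection `M → M/⟨x⟩^m M` as an `A`-linear map. -/
def piQ (m : ℕ) : M →ₗ[A] fibQ A n M m :=
  (Submodule.mkQ _).restrictScalars A

/-- The kernel of `k(𝔭) ⊗ M → k(𝔭) ⊗ M/⟨x⟩^m M`. -/
def kerL (p : PrimeSpectrum A) (m : ℕ) : Submodule (resF A p) (resF A p ⊗[A] M) :=
  Submodule.baseChange (resF A p)
    (((xIdeal A n ^ m) • (⊤ : Submodule (MvPowerSeries (Fin n) A) M)).restrictScalars A)

lemma piQ_surj (p : PrimeSpectrum A) (m : ℕ) :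
    Function.Surjective ((piQ A n M m).baseChange (resF A p)) :=
  LinearMap.baseChange_surjective _ (Submodule.mkQ_surjective _)

lemma transQ_piQ (p : PrimeSpectrum A) (m : ℕ) (v : resF A p ⊗[A] M) :
    (transQ A n M m).baseChange (resF A p) ((piQ A n M (m + 1)).baseChange (resF A p) v) =
      (piQ A n M m).baseChange (resF A p) v := by
  rw [← LinearMap.comp_apply, ← LinearMap.baseChange_comp]
  rfl

lemma ker_piQ (p : PrimeSpectrum A) (m : ℕ) (v : resF A p ⊗[A] M) :
    (piQ A n M m).baseChange (resF A p) v = 0 ↔ v ∈ kerL A n M p m := by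
  have hex : Function.Exact
      ((((xIdeal A n ^ m) • (⊤ : Submodule (MvPowerSeries (Fin n) A) M)).restrictScalars A).subtype)
      (piQ A n M m) := by
    intro y
    simp [piQ]
  have h := lTensor_exact (resF A p) hex (Submodule.mkQ_surjective _)
  exact h v

lemma kerL_anti (p : PrimeSpectrum A) (m : ℕ) : kerL A n M p (m + 1) ≤ kerL A n M p m := by
  apply Submodule.baseChange_mono
  intro x hx
  exact Submodule.smul_mono_left (Ideal.pow_le_pow_right (Nat.le_succ m)) hx

lemma kerL_step (p : PrimeSpectrum A) (m : ℕ) (h : kerL A n M p m = kerL A n M p (m + 1)) :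
    kerL A n M p (m + 1) = kerL A n M p (m + 2) := by
  refine le_antisymm ?_ (kerL_anti A n M p (m + 1))
  -- multiplication by `r ∈ ⟨x⟩` maps `L_k` to `L_{k+1}`
  have hmul : ∀ r ∈ xIdeal A n, ∀ k : ℕ, ∀ v ∈ kerL A n M p k,
      ((Algebra.lsmul A A M r).baseChange (resF A p)) v ∈ kerL A n M p (k + 1) := by
    intro r hr k v hv
    have : kerL A n M p k ≤ (kerL A n M p (k + 1)).comap
        ((Algebra.lsmul A A M r).baseChange (resF A p)) := by
      conv_lhs => rw [kerL, Submodule.baseChange_eq_span]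
      rw [Submodule.span_le]
      rintro _ ⟨y, hy, rfl⟩
      simp only [SetLike.mem_coe, Submodule.mem_comap]
      change (1 : resF A p) ⊗ₜ[A] (r • y) ∈ _
      apply Submodule.tmul_mem_baseChange_of_mem
      change r • y ∈ xIdeal A n ^ (k + 1) • (⊤ : Submodule (MvPowerSeries (Fin n) A) M)
      rw [pow_succ', Submodule.mul_smul]
      exact Submodule.smul_mem_smul hr hy
    exact this hv
  conv_lhs => rw [kerL, Submodule.baseChange_eq_span]
  rw [Submodule.span_le]
  rintro _ ⟨y, hy, rfl⟩
  change y ∈ xIdeal A n ^ (m + 1) • (⊤ : Submodule (MvPowerSeries (Fin n) A) M) at hy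
  rw [pow_succ', Submodule.mul_smul] at hy
  change (1 : resF A p) ⊗ₜ[A] y ∈ kerL A n M p (m + 2)
  induction hy using Submodule.smul_induction_on' with
  | smul r hr z hz =>
    refine hmul r hr (m + 1) ((1 : resF A p) ⊗ₜ[A] z) ?_
    rw [← h]
    exact Submodule.tmul_mem_baseChange_of_mem _ hz
  | add y₁ _ y₂ _ h₁ h₂ =>
    rw [TensorProduct.tmul_add]
    exact add_mem h₁ h₂

lemma kerL_stable [Module.Finite A M] (p : PrimeSpectrum A) (g : ℕ)
    (hg : Module.finrank (resF A p) (resF A p ⊗[A] M) ≤ g) (m : ℕ) (hm : g ≤ m) :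
    kerL A n M p m = kerL A n M p (m + 1) := by
  have hprop : ∀ k j, kerL A n M p k = kerL A n M p (k + 1) →
      kerL A n M p (k + j) = kerL A n M p (k + j + 1) := by
    intro k j h
    induction j with
    | zero => exact h
    | succ j ih => exact kerL_step A n M p _ ih
  by_contra hne
  have hlt : ∀ k ≤ m, kerL A n M p (k + 1) < kerL A n M p k := by
    intro k hk
    refine lt_of_le_of_ne (kerL_anti A n M p k) fun h => hne ?_
    obtain ⟨j, rfl⟩ := Nat.exists_eq_add_of_le hk
    exact hprop k j h.symm
  have hdim : ∀ k ≤ m + 1, Module.finrank (resF A p) (kerL A n M p k) + k ≤ g := by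
    intro k
    induction k with
    | zero => intro _; exact (Submodule.finrank_le _).trans hg
    | succ k ih =>
      intro hk
      have h1 := ih (by omega)
      have h2 := Submodule.finrank_lt_finrank_of_lt (hlt k (by omega))
      omega
  have := hdim (m + 1) le_rfl
  omega

lemma dHat_eq [Module.Finite A M] (p : PrimeSpectrum A) (g : ℕ)
    (hg : Module.finrank (resF A p) (resF A p ⊗[A] M) ≤ g) :
    dHat A n M p = Module.finrank (resF A p) (resF A p ⊗[A] fibQ A n M g) := by
  let π : completedFibre A n M p →ₗ[resF A p] (resF A p ⊗[A] fibQ A n M g) :=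
    (LinearMap.proj g).comp (completedFibre A n M p).subtype
  have hinj : Function.Injective π := by
    rw [injective_iff_map_eq_zero]
    rintro ⟨f, hf⟩ h0
    have h0 : f g = 0 := h0
    have hf : ∀ m, (transQ A n M m).baseChange (resF A p) (f (m + 1)) = f m := hf
    have hup : ∀ j, f (g + j) = 0 := by
      intro j
      induction j with
      | zero => exact h0
      | succ j ih =>
        obtain ⟨v, hv⟩ := piQ_surj A n M p (g + j + 1) (f (g + j + 1))
        have h1 := hf (g + j)
        rw [← hv, transQ_piQ, ih, ker_piQ, kerL_stable A n M p g hg (g + j) (by omega),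
          ← ker_piQ, hv] at h1
        exact h1
    have hdown : ∀ j, ∀ k, f (k + j) = 0 → f k = 0 := by
      intro j
      induction j with
      | zero => intro k h; exact h
      | succ j ih =>
        intro k h
        apply ih
        rw [← hf (k + j)]
        have h : f (k + j + 1) = 0 := h
        rw [h, map_zero]
    ext m
    apply hdown g m
    rw [add_comm]
    exact hup m
  have hsurj : Function.Surjective π := by
    intro w
    obtain ⟨v, hv⟩ := piQ_surj A n M p g w
    exact ⟨⟨fun m => (piQ A n M m).baseChange (resF A p) v,
      fun m => transQ_piQ A n M p m v⟩, hv⟩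
  exact (LinearEquiv.ofBijective π ⟨hinj, hsurj⟩).finrank_eq

lemma finite_fibQ [Module.Finite A M] (m : ℕ) : Module.Finite A (fibQ A n M m) :=
  Module.Finite.of_surjective (piQ A n M m) (Submodule.mkQ_surjective _)

lemma exists_bound [Module.Finite A M] : ∃ g : ℕ, ∀ p : PrimeSpectrum A,
    Module.finrank (resF A p) (resF A p ⊗[A] M) ≤ g := by
  obtain ⟨g, f, hf⟩ := Module.Finite.exists_fin' A M
  refine ⟨g, fun p => ?_⟩
  have h := LinearMap.finrank_le_finrank_of_surjective
    (LinearMap.baseChange_surjective (resF A p) hf)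
  have : Nontrivial A := p.nontrivial
  rwa [Module.finrank_baseChange (R := resF A p) (M' := Fin g → A), Module.finrank_fin_fun] at h

/-- Let `A` be Noetherian, `R = A[[x₁,...,xₙ]]`, and `M` a finitely
generated `R`-module which is also finitely generated over `A`.  Then for every prime
`𝔭` the completed fibre dimension satisfies `d̂_𝔭(M) ≤ dim_{k(𝔭)} M ⊗_A k(𝔭)`, and
`𝔭 ↦ d̂_𝔭(M)` is upper semicontinuous on `Spec A`. -/
theorem completed_fibre_dimension_le_and_semicontinuous
    [IsNoetherianRing A] [Module.Finite (MvPowerSeries (Fin n) A) M]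
    [Module.Finite A M] :
    (∀ p : PrimeSpectrum A,
      dHat A n M p ≤ Module.finrank (resF A p) ((resF A p) ⊗[A] M)) ∧
    (∀ p : PrimeSpectrum A,
      ∃ U : Set (PrimeSpectrum A), IsOpen U ∧ p ∈ U ∧ ∀ q ∈ U,
        dHat A n M q ≤ dHat A n M p) := by
  obtain ⟨g, hg⟩ := exists_bound A M
  refine ⟨fun p => ?_, fun p => ?_⟩
  · rw [dHat_eq A n M p g (hg p)]
    exact LinearMap.finrank_le_finrank_of_surjective (piQ_surj A n M p g)
  · have := finite_fibQ A n M g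
    obtain ⟨U, hU, hpU, h⟩ := aux_fibre_rank_usc A (fibQ A n M g) p
    refine ⟨U, hU, hpU, fun q hq => ?_⟩
    rw [dHat_eq A n M p g (hg p), dHat_eq A n M q g (hg q)]
    exact h q hq

end
end

section
/- Let F ∈ ℤ[x₁,...,xₙ], p a prime number, F_p the image of F in 𝔽_p[[x]] and F₀ the image in ℚ[[x]]. If the Milnor number μ(F_p) = dim_{𝔽_p} 𝔽_p[[x]]/j(F_p) is finite, then μ(F₀) = dim_ℚ ℚ[[x]]/j(F₀) is finite and μ(F₀) ≤ μ(F_p). -/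
set_option synthInstance.maxHeartbeats 1000000
set_option maxHeartbeats 1000000

/-- The Milnor algebra `k[[x₁,...,xₙ]]/j(f)` of a polynomial `f`, where
`j(f) = ⟨∂f/∂x₁,...,∂f/∂xₙ⟩` is the Jacobian ideal; its `k`-dimension is the Milnor
number `μ(f)`. -/
abbrev MilnorAlgebra (k : Type) [CommRing k] (n : ℕ) (f : MvPolynomial (Fin n) k) : Type :=
  MvPowerSeries (Fin n) k ⧸ Ideal.span (Set.range fun i : Fin n =>
    MvPolynomial.coeToMvPowerSeries.ringHom (MvPolynomial.pderiv i f))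

open MvPowerSeries in
theorem aux_mem_span_X {R : Type} [CommRing R] {n : ℕ} (s : Finset (Fin n)) :
    ∀ f : MvPowerSeries (Fin n) R,
      (∀ m : Fin n →₀ ℕ, (∀ i ∈ s, m i = 0) → coeff m f = 0) →
      f ∈ Ideal.span (Set.range (X : Fin n → MvPowerSeries (Fin n) R)) := by
  classical
  induction s using Finset.induction_on with
  | empty =>
    intro f hf
    have : f = 0 := by
      ext m
      simpa using hf m (by simp)
    rw [this]; exact Ideal.zero_mem _
  | insert i s hi ih =>
    intro f hf
    let g : MvPowerSeries (Fin n) R := fun m => if m i = 0 then coeff m f else 0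
    have hg : ∀ m, coeff m g = if m i = 0 then coeff m f else 0 := fun m => rfl
    have h1 : g ∈ Ideal.span (Set.range (X : Fin n → MvPowerSeries (Fin n) R)) := by
      apply ih
      intro m hm
      rw [hg]
      split_ifs with h0
      · apply hf
        intro j hj
        rcases Finset.mem_insert.1 hj with rfl | hj
        · exact h0
        · exact hm j hj
      · rfl
    have h2 : (X i : MvPowerSeries (Fin n) R) ∣ f - g := by
      rw [X_dvd_iff]
      intro m hm
      rw [map_sub, hg, if_pos hm, sub_self]
    have h3 : f - g ∈ Ideal.span (Set.range (X : Fin n → MvPowerSeries (Fin n) R)) :=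
      Ideal.mem_of_dvd _ h2 (Ideal.subset_span ⟨i, rfl⟩)
    have := Ideal.add_mem _ h3 h1
    simpa using this

open MvPowerSeries in
theorem aux_const {R : Type} [CommRing R] {n : ℕ} (f : MvPowerSeries (Fin n) R) :
    ∃ c : R, f - algebraMap R _ c ∈
      Ideal.span (Set.range (X : Fin n → MvPowerSeries (Fin n) R)) := by
  classical
  refine ⟨constantCoeff f, aux_mem_span_X Finset.univ _ ?_⟩
  intro m hm
  have : m = 0 := by ext i; simpa using hm i (Finset.mem_univ i)
  subst this
  simp [MvPowerSeries.algebraMap_apply]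

theorem aux_trunc {R B : Type} [CommRing R] [CommRing B] [Algebra R B] {n : ℕ} (x : Fin n → B)
    (hB : ∀ f : B, ∃ c : R, f - algebraMap R B c ∈ Ideal.span (Set.range x))
    (P : Submonoid B) (hP : ∀ i, x i ∈ P) (k : ℕ) :
    ∃ T : Set B, T.Finite ∧ T ⊆ P ∧
      ∀ f : B, ∃ t ∈ Submodule.span R T, f - t ∈ Ideal.span (Set.range x) ^ k := by
  induction k with
  | zero => exact ⟨∅, Set.finite_empty, by simp, fun f => ⟨0, by simp, by simp⟩⟩
  | succ k ih =>
    obtain ⟨T, hT, hTP, h⟩ := ih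
    refine ⟨{1} ∪ ⋃ i, (fun t => x i * t) '' T, ?_, ?_, ?_⟩
    · exact (Set.finite_singleton _).union (Set.finite_iUnion fun i => hT.image _)
    · rintro y (rfl | hy)
      · exact P.one_mem
      · obtain ⟨i, t, ht, rfl⟩ := Set.mem_iUnion.1 hy
        exact P.mul_mem (hP i) (hTP ht)
    · intro f
      obtain ⟨c, hc⟩ := hB f
      obtain ⟨g, hg⟩ := (Ideal.mem_span_range_iff_exists_fun).1 hc
      choose t ht htk using fun i => h (g i)
      refine ⟨algebraMap R B c + ∑ i, x i * t i, ?_, ?_⟩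
      · refine Submodule.add_mem _ ?_ (Submodule.sum_mem _ fun i _ => ?_)
        · rw [Algebra.algebraMap_eq_smul_one]
          exact Submodule.smul_mem _ _ (Submodule.subset_span (Or.inl rfl))
        · have := Submodule.mem_map_of_mem (f := LinearMap.mulLeft R (x i)) (ht i)
          rw [Submodule.map_span] at this
          refine Submodule.span_mono ?_ this
          rintro _ ⟨y, hy, rfl⟩
          exact Or.inr (Set.mem_iUnion.2 ⟨i, y, hy, rfl⟩)
      · have : f - (algebraMap R B c + ∑ i, x i * t i) = ∑ i, x i * (g i - t i) := by
          have e : f = algebraMap R B c + ∑ i, g i * x i := by rw [hg]; ring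
          rw [e, add_sub_add_left_eq_sub, ← Finset.sum_sub_distrib]
          exact Finset.sum_congr rfl fun i _ => by ring
        rw [this, pow_succ']
        exact Ideal.sum_mem _ fun i _ =>
          Ideal.mul_mem_mul (Ideal.subset_span ⟨i, rfl⟩) (htk i)

/-- Nakayama on the integral side. -/
theorem aux_int {B : Type} [CommRing B] {n d : ℕ} (x : Fin n → B)
    (hB : ∀ f : B, ∃ c : ℤ, f - algebraMap ℤ B c ∈ Ideal.span (Set.range x))
    (J : Ideal B) (e : Fin d → B) (p : ℕ) (hp : p.Prime)
    (he : ∀ f : B, ∃ t ∈ Submodule.span ℤ (Set.range e), ∃ j ∈ J, ∃ h : B,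
      f = t + j + (p : ℤ) • h) (k : ℕ) :
    ∃ r : ℤ, r ≠ 0 ∧ ∀ f : B, ∃ t ∈ Submodule.span ℤ (Set.range e), ∃ j ∈ J,
      r • f - t - j ∈ Ideal.span (Set.range x) ^ k := by
  obtain ⟨T, hT, -, hTk⟩ := aux_trunc x hB ⊤ (fun _ => trivial) k
  let N : Submodule ℤ B := Submodule.span ℤ (Set.range e) ⊔
    (J.restrictScalars ℤ ⊔ (Ideal.span (Set.range x) ^ k).restrictScalars ℤ)
  have hspan : Submodule.span ℤ (N.mkQ '' T) = ⊤ := by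
    rw [eq_top_iff]
    rintro y -
    obtain ⟨f, rfl⟩ := N.mkQ_surjective y
    obtain ⟨t, ht, hft⟩ := hTk f
    have : N.mkQ f = N.mkQ t := by
      rw [← sub_eq_zero, ← map_sub, Submodule.mkQ_apply, Submodule.Quotient.mk_eq_zero]
      exact Submodule.mem_sup_right (Submodule.mem_sup_right hft)
    rw [this, ← Submodule.map_span]
    exact Submodule.mem_map_of_mem ht
  have hfg : (⊤ : Submodule ℤ (B ⧸ N)).FG := by
    rw [← hspan]; exact Submodule.fg_span (hT.image _)
  obtain ⟨r, hr, hr'⟩ := Submodule.exists_sub_one_mem_and_smul_eq_zero_of_fg_of_le_smul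
    (Ideal.span {(p : ℤ)}) _ hfg (by
      rintro y -
      obtain ⟨f, rfl⟩ := N.mkQ_surjective y
      obtain ⟨t, ht, j, hj, h, rfl⟩ := he f
      have h0 : N.mkQ (t + j) = 0 := by
        rw [Submodule.mkQ_apply, Submodule.Quotient.mk_eq_zero]
        exact N.add_mem (Submodule.mem_sup_left ht)
          (Submodule.mem_sup_right (Submodule.mem_sup_left hj))
      rw [map_add, h0, zero_add, map_smul]
      exact Submodule.smul_mem_smul (Ideal.mem_span_singleton_self _) trivial)
  refine ⟨r, ?_, ?_⟩
  · rintro rfl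
    rw [Ideal.mem_span_singleton] at hr
    have : (p : ℤ) ∣ 1 := by simpa using hr
    exact hp.one_lt.ne' (by exact_mod_cast Int.eq_one_of_dvd_one (by positivity) this)
  · intro f
    have := hr' (N.mkQ f) trivial
    rw [← map_smul, Submodule.mkQ_apply, Submodule.Quotient.mk_eq_zero] at this
    obtain ⟨t, ht, y, hy, hty⟩ := Submodule.mem_sup.1 this
    obtain ⟨j, hj, z, hz, rfl⟩ := Submodule.mem_sup.1 hy
    refine ⟨t, ht, j, hj, ?_⟩
    rw [← hty]
    have : t + (j + z) - t - j = z := by ring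
    rw [this]; exact hz

/-- Stabilisation over a field. -/
theorem aux_field {K B : Type} [Field K] [CommRing B] [IsNoetherianRing B] [Algebra K B] {d : ℕ}
    (m : Ideal B) (hm : m ≤ Ideal.jacobson ⊥) (J : Ideal B) (e : Fin d → B)
    (h : ∀ k : ℕ, ∀ f : B, ∃ t ∈ Submodule.span K (Set.range e), ∃ j ∈ J, f - t - j ∈ m ^ k) :
    Module.Finite K (B ⧸ J) ∧ Module.finrank K (B ⧸ J) ≤ d := by
  let q : B →ₗ[K] (B ⧸ J) := (Ideal.Quotient.mkₐ K J).toLinearMap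
  have hq : Function.Surjective q := Ideal.Quotient.mk_surjective
  let W : Submodule K (B ⧸ J) := Submodule.span K (Set.range (q ∘ e))
  have : Module.Finite K W := Module.Finite.span_of_finite K (Set.finite_range _)
  let V : ℕ → Submodule B (B ⧸ J) := fun k => m ^ k • ⊤
  have hV : ∀ k, V (k + 1) ≤ V k := fun k =>
    Submodule.smul_mono_left (Ideal.pow_le_pow_right (Nat.le_succ k))
  have hVm : ∀ k (z : B), z ∈ m ^ k → q z ∈ V k := by
    intro k z hz
    have : q z = z • (1 : B ⧸ J) := by
      change Ideal.Quotient.mk J z = _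
      rw [Algebra.smul_def, mul_one]; rfl
    rw [this]
    exact Submodule.smul_mem_smul hz trivial
  have hWV : ∀ k (y : B ⧸ J), ∃ w ∈ W, y - w ∈ V k := by
    intro k y
    obtain ⟨f, rfl⟩ := hq y
    obtain ⟨t, ht, j, hj, hk⟩ := h k f
    refine ⟨q t, ?_, ?_⟩
    · have := Submodule.mem_map_of_mem (f := q) ht
      rwa [Submodule.map_span, ← Set.range_comp] at this
    · have hj0 : q j = 0 := Ideal.Quotient.eq_zero_iff_mem.2 hj
      have := hVm k _ hk
      rwa [map_sub, map_sub, hj0, sub_zero] at this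
  let c : ℕ →o (Submodule K W)ᵒᵈ :=
    ⟨fun k => OrderDual.toDual (((V k).restrictScalars K).comap W.subtype),
      monotone_nat_of_le_succ fun k => by
        intro w hw
        exact hV k hw⟩
  obtain ⟨k, hk⟩ := IsArtinian.monotone_stabilizes c
  have hk1 := hk (k + 1) (Nat.le_succ k)
  have hVk : V k ≤ m • V k := by
    intro y hy
    obtain ⟨w, hw, hyw⟩ := hWV (k + 1) y
    have hwk : w ∈ V k := by
      have := (V k).sub_mem hy (hV k hyw)
      simpa using this
    have hwk1 : w ∈ V (k + 1) := by
      have h1 : (⟨w, hw⟩ : W) ∈ OrderDual.ofDual (c k) := hwk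
      rw [hk1] at h1
      exact h1
    have : y ∈ V (k + 1) := by
      have := (V (k + 1)).add_mem hyw hwk1
      simpa using this
    have e1 : V (k + 1) = m • V k := by
      simp only [V]
      rw [pow_succ', Submodule.mul_smul]
    rwa [e1] at this
  have hbot : V k = ⊥ :=
    Submodule.eq_bot_of_le_smul_of_le_jacobson_bot m (V k) (IsNoetherian.noetherian _) hVk hm
  have hWtop : W = ⊤ := by
    rw [eq_top_iff]
    rintro y -
    obtain ⟨w, hw, hyw⟩ := hWV k y
    rw [hbot, Submodule.mem_bot, sub_eq_zero] at hyw
    rwa [hyw]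
  refine ⟨⟨?_⟩, ?_⟩
  · rw [← hWtop]; exact Submodule.fg_span (Set.finite_range _)
  · have := finrank_range_le_card (R := K) (q ∘ e)
    rw [Set.finrank] at this
    change Module.finrank K W ≤ _ at this
    rw [hWtop, finrank_top, Fintype.card_fin] at this
    exact this

/-- Lifting generators from `𝔽_p` to `ℤ`. -/
theorem aux_lift {B C : Type} [CommRing B] [CommRing C] (p : ℕ) [Fact p.Prime] [Algebra (ZMod p) C]
    {n : ℕ} (φ : B →+* C) (hφ : Function.Surjective φ)
    (hker : ∀ b, φ b = 0 → ∃ h : B, b = (p : ℤ) • h) (a : Fin n → B)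
    (hfin : Module.Finite (ZMod p) (C ⧸ Ideal.span (Set.range fun i => φ (a i)))) :
    ∃ e : Fin (Module.finrank (ZMod p) (C ⧸ Ideal.span (Set.range fun i => φ (a i)))) → B,
      ∀ f : B, ∃ t ∈ Submodule.span ℤ (Set.range e), ∃ j ∈ Ideal.span (Set.range a), ∃ h : B,
      f = t + j + (p : ℤ) • h := by
  set I := Ideal.span (Set.range fun i => φ (a i)) with hI
  let b := Module.finBasis (ZMod p) (C ⧸ I)
  have hsur : Function.Surjective fun x : B => Ideal.Quotient.mk I (φ x) :=
    Ideal.Quotient.mk_surjective.comp hφ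
  choose e he' using fun i => hsur (b i)
  have he : ∀ i, Ideal.Quotient.mk I (φ (e i)) = b i := he'
  refine ⟨e, fun f => ?_⟩
  let y : C ⧸ I := Ideal.Quotient.mk I (φ f)
  let t : B := ∑ i, ((b.repr y i).val : ℤ) • e i
  have ht : t ∈ Submodule.span ℤ (Set.range e) :=
    Submodule.sum_mem _ fun i _ => Submodule.smul_mem _ _ (Submodule.subset_span ⟨i, rfl⟩)
  have hty : Ideal.Quotient.mk I (φ t) = y := by
    conv_rhs => rw [← b.sum_repr y]
    simp only [t, map_sum]
    refine Finset.sum_congr rfl fun i _ => ?_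
    rw [map_zsmul, map_zsmul, he]
    conv_rhs => rw [← ZMod.natCast_zmod_val (b.repr y i)]
    rw [natCast_zsmul, Nat.cast_smul_eq_nsmul (ZMod p)]
  have h1 : φ (f - t) ∈ I := by
    rw [← Ideal.Quotient.eq_zero_iff_mem, map_sub, map_sub, hty, sub_self]
  obtain ⟨g, hg⟩ := (Ideal.mem_span_range_iff_exists_fun).1 h1
  choose g' hg' using fun i => hφ (g i)
  obtain ⟨h, hh⟩ := hker (f - t - ∑ i, g' i * a i) (by
    rw [map_sub, ← hg, map_sum, sub_eq_zero]
    exact Finset.sum_congr rfl fun i _ => by rw [map_mul, hg'])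
  refine ⟨t, ht, ∑ i, g' i * a i, ?_, h, ?_⟩
  · exact Ideal.sum_mem _ fun i _ => Ideal.mul_mem_left _ _ (Ideal.subset_span ⟨i, rfl⟩)
  · rw [← hh]; ring

theorem aux_coe_map {R S : Type} [CommRing R] [CommRing S] (φ : R →+* S) {n : ℕ}
    (F : MvPolynomial (Fin n) R) (i : Fin n) :
    MvPolynomial.coeToMvPowerSeries.ringHom (MvPolynomial.pderiv i (F.map φ)) =
      MvPowerSeries.map φ
        (MvPolynomial.coeToMvPowerSeries.ringHom (MvPolynomial.pderiv i F)) := by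
  rw [MvPolynomial.pderiv_map]
  ext m
  simp [MvPolynomial.coeff_map]

/-- Let `F ∈ ℤ[x₁,...,xₙ]`, `p` a prime, `F_p` its image in `𝔽_p[[x]]`
and `F₀` its image in `ℚ[[x]]`.  If `μ(F_p) < ∞` then `μ(F₀) < ∞` and
`μ(F₀) ≤ μ(F_p)`. -/
theorem milnor_number_rat_le_milnor_number_mod_p
    (n : ℕ) (F : MvPolynomial (Fin n) ℤ) (p : ℕ) [Fact p.Prime]
    (hp : Module.Finite (ZMod p)
      (MilnorAlgebra (ZMod p) n (F.map (Int.castRingHom (ZMod p))))) :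
    Module.Finite ℚ (MilnorAlgebra ℚ n (F.map (Int.castRingHom ℚ))) ∧
    Module.finrank ℚ (MilnorAlgebra ℚ n (F.map (Int.castRingHom ℚ))) ≤
      Module.finrank (ZMod p)
        (MilnorAlgebra (ZMod p) n (F.map (Int.castRingHom (ZMod p)))) := by
  classical
  let Z := MvPowerSeries (Fin n) ℤ
  let a : Fin n → MvPowerSeries (Fin n) ℤ := fun i =>
    MvPolynomial.coeToMvPowerSeries.ringHom (MvPolynomial.pderiv i F)
  have hap : ∀ {S : Type} [CommRing S] (φ : ℤ →+* S), (fun i : Fin n =>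
      MvPolynomial.coeToMvPowerSeries.ringHom (MvPolynomial.pderiv i (F.map φ))) =
      fun i => MvPowerSeries.map φ (a i) := fun φ => funext fun i => aux_coe_map φ F i
  unfold MilnorAlgebra at *
  rw [hap] at hp ⊢
  rw [hap]
  obtain ⟨e, he⟩ := aux_lift p (MvPowerSeries.map (σ := Fin n) (Int.castRingHom (ZMod p)))
    (by
      intro f
      choose g hg using fun m => ZMod.intCast_surjective (MvPowerSeries.coeff m f)
      let G : MvPowerSeries (Fin n) ℤ := g
      refine ⟨G, ?_⟩
      ext m
      rw [MvPowerSeries.coeff_map]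
      exact hg m)
    (by
      intro b hb
      have : ∀ m, (p : ℤ) ∣ MvPowerSeries.coeff m b := by
        intro m
        have := congrArg (MvPowerSeries.coeff m) hb
        rw [MvPowerSeries.coeff_map, map_zero] at this
        exact (ZMod.intCast_zmod_eq_zero_iff_dvd _ p).1 this
      choose g hg using this
      let G : MvPowerSeries (Fin n) ℤ := g
      refine ⟨G, ?_⟩
      ext m
      rw [hg m, map_zsmul, smul_eq_mul]
      rfl) a hp
  let φ := MvPowerSeries.map (σ := Fin n) (Int.castRingHom ℚ)
  have hφX : ∀ i, φ (MvPowerSeries.X i) = MvPowerSeries.X i := fun i => MvPowerSeries.map_X _ i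
  have hJ : ∀ j ∈ Ideal.span (Set.range a),
      φ j ∈ Ideal.span (Set.range fun i => φ (a i)) := by
    intro j hj
    have := Ideal.mem_map_of_mem φ hj
    rwa [Ideal.map_span, ← Set.range_comp] at this
  have hM : ∀ k, ∀ j ∈ Ideal.span (Set.range (MvPowerSeries.X : Fin n → MvPowerSeries (Fin n) ℤ)) ^ k,
      φ j ∈ Ideal.span (Set.range (MvPowerSeries.X : Fin n → MvPowerSeries (Fin n) ℚ)) ^ k := by
    intro k j hj
    have := Ideal.mem_map_of_mem φ hj
    rw [Ideal.map_pow, Ideal.map_span, ← Set.range_comp] at this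
    have e1 : (φ ∘ MvPowerSeries.X : Fin n → MvPowerSeries (Fin n) ℚ) = MvPowerSeries.X :=
      funext hφX
    rwa [e1] at this
  have hS : ∀ t ∈ Submodule.span ℤ (Set.range e),
      φ t ∈ Submodule.span ℚ (Set.range (φ ∘ e)) := by
    intro t ht
    induction ht using Submodule.span_induction with
    | mem x hx =>
      obtain ⟨i, rfl⟩ := hx
      exact Submodule.subset_span ⟨i, rfl⟩
    | zero => rw [map_zero]; exact Submodule.zero_mem _
    | add x y _ _ hx hy => rw [map_add]; exact Submodule.add_mem _ hx hy
    | smul r x _ hx =>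
      rw [map_zsmul, ← Int.cast_smul_eq_zsmul ℚ]; exact Submodule.smul_mem _ _ hx
  refine aux_field (Ideal.span (Set.range MvPowerSeries.X)) (IsAdicComplete.le_jacobson_bot _)
    _ (φ ∘ e) ?_
  intro k
  obtain ⟨r, hr, hr'⟩ := aux_int MvPowerSeries.X (fun f => by
      obtain ⟨c, hc⟩ := aux_const f
      refine ⟨c, ?_⟩
      rw [eq_intCast] at hc ⊢
      exact hc) (Ideal.span (Set.range a)) e p
    Fact.out he k
  obtain ⟨T, -, hTP, hT⟩ := aux_trunc (R := ℚ) (B := MvPowerSeries (Fin n) ℚ) MvPowerSeries.X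
    aux_const φ.range.toSubmonoid (fun i => ⟨MvPowerSeries.X i, hφX i⟩) k
  let N : Submodule ℚ (MvPowerSeries (Fin n) ℚ) := Submodule.span ℚ (Set.range (φ ∘ e)) ⊔
    ((Ideal.span (Set.range fun i => φ (a i))).restrictScalars ℚ ⊔
      (Ideal.span (Set.range (MvPowerSeries.X : Fin n → MvPowerSeries (Fin n) ℚ)) ^ k).restrictScalars ℚ)
  have hTN : Submodule.span ℚ T ≤ N := by
    rw [Submodule.span_le]
    intro y hy
    obtain ⟨f, rfl⟩ := hTP hy
    obtain ⟨t, ht, j, hj, hm⟩ := hr' f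
    have h1 : φ (r • f) ∈ N := by
      have : r • f = t + (j + (r • f - t - j)) := by ring
      rw [this, map_add, map_add]
      exact Submodule.add_mem_sup (hS t ht) (Submodule.add_mem_sup (hJ j hj) (hM k _ hm))
    rw [map_zsmul, ← Int.cast_smul_eq_zsmul ℚ] at h1
    exact (Submodule.smul_mem_iff N (Int.cast_ne_zero.2 hr)).1 h1
  intro f
  obtain ⟨s, hs, hfs⟩ := hT f
  obtain ⟨t, ht, y, hy, hty⟩ := Submodule.mem_sup.1 (hTN hs)
  obtain ⟨j, hj, z, hz, rfl⟩ := Submodule.mem_sup.1 hy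
  refine ⟨t, ht, j, hj, ?_⟩
  have : f - t - j = (f - s) + z := by rw [← hty]; ring
  rw [this]
  exact Ideal.add_mem _ hfs hz
end
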